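/- arXiv:1211.4184 — 3 statements merged into one kernel-verified Lean document; each statement's English description precedes it below -/
import Mathlib

section
/- There exists an absolute constant c > 0 (one may take c = 1/4) with the following property: for every positive integer k and every ε > 0 there exists C = C(k,ε) > 0 such that for every prime p and every interval I ⊂ F_p not containing 0 with |I| < p^{c/k²}, the number J_{2k} of tuples (x_1,…,x_{2k}) ∈ I^{2k} satisfying x_1^{-1} + … + x_k^{-1} = x_{k+1}^{-1} + … + x_{2k}^{-1} in F_p satisfies J_{2k} ≤ C·|I|^{k+ε}. -/
open Finset

/-- The interval `{a+1, a+2, …, a+N}` in `ZMod p`. -/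
def interval (p : ℕ) (a : ZMod p) (N : ℕ) : Finset (ZMod p) :=
  (Finset.Icc 1 N).image (fun i : ℕ => a + (i : ZMod p))

open Polynomial

theorem Nat.exists_card_divisors_le_rpow {δ : ℝ} (hδ : 0 < δ) :
    ∃ C : ℝ, 1 ≤ C ∧ ∀ n : ℕ, n ≠ 0 → (#n.divisors : ℝ) ≤ C * (n : ℝ) ^ δ := by
  have hlog : 0 < Real.log 2 := Real.log_pos one_lt_two
  set K : ℝ := max 1 (1 / (δ * Real.log 2)) with hK
  have hK1 : 1 ≤ K := le_max_left _ _
  have hK2 : 1 ≤ K * (δ * Real.log 2) := by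
    rw [← div_le_iff₀ (by positivity)]
    exact le_max_right _ _
  obtain ⟨P, hP⟩ := exists_nat_gt ((2 : ℝ) ^ (1 / δ))
  refine ⟨K ^ P, one_le_pow₀ hK1, fun n hn => ?_⟩
  have hterm : ∀ q ∈ n.primeFactors, ((n.factorization q + 1 : ℕ) : ℝ) ≤
      (if q < P then K else 1) * ((q : ℝ) ^ n.factorization q) ^ δ := by
    intro q hq
    have hq2 : (2 : ℝ) ≤ q := by exact_mod_cast (Nat.prime_of_mem_primeFactors hq).two_le
    generalize n.factorization q = e
    rw [← Real.rpow_natCast_mul (by positivity), mul_comm (e : ℝ), Real.rpow_mul (by positivity),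
      Real.rpow_natCast]
    push_cast
    split_ifs with h
    · have h1 : 1 + (δ * Real.log 2) * e ≤ ((q : ℝ) ^ δ) ^ e := by
        calc 1 + (δ * Real.log 2) * e ≤ Real.exp ((δ * Real.log 2) * e) := by
              linarith [Real.add_one_le_exp ((δ * Real.log 2) * e)]
          _ = ((2 : ℝ) ^ δ) ^ e := by
              rw [Real.rpow_def_of_pos two_pos, ← Real.exp_nat_mul]; ring_nf
          _ ≤ _ := by gcongr
      calc (e : ℝ) + 1 ≤ K * (1 + (δ * Real.log 2) * e) := by
            nlinarith [mul_le_mul_of_nonneg_right hK2 (Nat.cast_nonneg (α := ℝ) e)]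
        _ ≤ _ := by gcongr
    · have h2 : (2 : ℝ) ≤ (q : ℝ) ^ δ := by
        have : (2 : ℝ) ^ (1 / δ) ≤ q := hP.le.trans (by exact_mod_cast not_lt.1 h)
        calc (2 : ℝ) = ((2 : ℝ) ^ (1 / δ)) ^ δ := by
              rw [← Real.rpow_mul two_pos.le, one_div_mul_cancel hδ.ne', Real.rpow_one]
          _ ≤ _ := by gcongr
      rw [one_mul]
      calc (e : ℝ) + 1 ≤ 2 ^ e := by exact_mod_cast Nat.lt_two_pow_self (n := e)
        _ ≤ _ := by gcongr
  calc (#n.divisors : ℝ) = ∏ q ∈ n.primeFactors, ((n.factorization q + 1 : ℕ) : ℝ) := by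
        rw [Nat.card_divisors hn]; push_cast; rfl
    _ ≤ ∏ q ∈ n.primeFactors, (if q < P then K else 1) * ((q : ℝ) ^ n.factorization q) ^ δ :=
        prod_le_prod (fun _ _ => by positivity) hterm
    _ = (∏ q ∈ n.primeFactors, if q < P then K else 1) * (n : ℝ) ^ δ := by
        rw [prod_mul_distrib, Real.finsetProd_rpow _ _ (fun _ _ => by positivity)]
        congr 2
        exact_mod_cast Nat.prod_factorization_pow_eq_self hn
    _ ≤ K ^ P * (n : ℝ) ^ δ := by
        gcongr
        rw [prod_ite, prod_const_one, mul_one, prod_const]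
        refine pow_le_pow_right₀ hK1 ?_
        calc _ ≤ #(range P) := card_le_card fun q hq => by simp at hq ⊢; exact hq.2
          _ = P := card_range P

theorem Real.one_add_log_le_rpow {δ x : ℝ} (hδ : 0 < δ) (hx : 1 ≤ x) :
    1 + Real.log x ≤ (1 + 1 / δ) * x ^ δ := by
  have h1 := Real.log_le_rpow_div (zero_le_one.trans hx) hδ
  have h2 := Real.one_le_rpow hx hδ.le
  calc _ ≤ x ^ δ + x ^ δ / δ := add_le_add h2 h1
    _ = _ := by ring

theorem Nat.gcd_lcm_dvd_lcm_gcd (f u v : ℕ) :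
    f.gcd (u.lcm v) ∣ (f.gcd u).lcm (f.gcd v) := by
  rcases eq_or_ne f 0 with rfl | hf
  · simp
  rcases eq_or_ne u 0 with rfl | hu
  · simpa using Nat.dvd_lcm_left _ _
  rcases eq_or_ne v 0 with rfl | hv
  · simpa using Nat.dvd_lcm_right _ _
  rw [← Nat.factorization_le_iff_dvd (by simp [hf]) (by simp [hf])]
  rw [Nat.factorization_gcd hf (Nat.lcm_ne_zero hu hv), Nat.factorization_lcm hu hv,
    Nat.factorization_lcm (by simp [hf]) (by simp [hf]), Nat.factorization_gcd hf hu,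
    Nat.factorization_gcd hf hv]
  intro q
  simp only [Finsupp.inf_apply, Finsupp.sup_apply]
  exact inf_sup_left _ _ _ |>.le

theorem Nat.gcd_finsetLcm_dvd {ι : Type*} (f : ℕ) (s : Finset ι) (g : ι → ℕ) :
    f.gcd (s.lcm g) ∣ s.lcm fun i => f.gcd (g i) := by
  classical
  induction s using Finset.induction_on with
  | empty => simp
  | insert i s _ ih =>
    rw [lcm_insert, lcm_insert]
    exact (Nat.gcd_lcm_dvd_lcm_gcd _ _ _).trans (lcm_dvd_lcm dvd_rfl ih)

/-- The numerator `∑ i, eᵢ ∏_{l ≠ i} (X + tₗ)` of the rational function `∑ i, eᵢ / (X + tᵢ)`. -/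
noncomputable def reciprocalNumerator {ι : Type*} [Fintype ι] [DecidableEq ι] (e t : ι → ℤ) :
    ℤ[X] :=
  ∑ i, C (e i) * ∏ l ∈ univ.erase i, (X + C (t l))

theorem Polynomial.IsPrimitive.coeff_zero_dvd_pow {Q P : ℤ[X]} (hQ : Q.IsPrimitive) (hQP : Q ∣ P)
    (hP : P.coeff 0 ≠ 0) {L : ℤ} (h : C (P.coeff 0) ∣ P.comp (C L * X)) :
    Q.coeff 0 ∣ L ^ Q.natDegree := by
  obtain ⟨H, rfl⟩ := hQP
  rw [mul_comp, ← dvd_content_iff_C_dvd, content_mul, mul_coeff_zero] at h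
  rw [mul_coeff_zero] at hP
  have hq : (Q.comp (C L * X)).content ∣ Q.coeff 0 := by
    have := content_dvd_coeff (p := Q.comp (C L * X)) 0
    rwa [comp_C_mul_X_coeff, pow_zero, mul_one] at this
  have hh : (H.comp (C L * X)).content ∣ H.coeff 0 := by
    have := content_dvd_coeff (p := H.comp (C L * X)) 0
    rwa [comp_C_mul_X_coeff, pow_zero, mul_one] at this
  have hqc : Q.coeff 0 ∣ (Q.comp (C L * X)).content := by
    have hH : H.coeff 0 ≠ 0 := right_ne_zero_of_mul hP
    exact (mul_dvd_mul_iff_right hH).1 (h.trans (mul_dvd_mul_left _ hh))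
  have hdvd : C (Q.coeff 0) ∣ C (L ^ Q.natDegree) * Q := by
    rw [C_dvd_iff_dvd_coeff]
    intro m
    rw [coeff_C_mul]
    rcases le_or_gt m Q.natDegree with hm | hm
    · have h1 := hqc.trans (content_dvd_coeff m)
      rw [comp_C_mul_X_coeff, mul_comm] at h1
      exact h1.trans (mul_dvd_mul_right (pow_dvd_pow _ hm) _)
    · simp [coeff_eq_zero_of_natDegree_lt hm]
  rw [← dvd_content_iff_C_dvd, content_C_mul, hQ.content_eq_one, mul_one] at hdvd
  exact (dvd_normalize_iff).1 hdvd

section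

variable {ι : Type*} [Fintype ι] [DecidableEq ι]

theorem reciprocalNumerator_comp (e t : ι → ℤ) (F : ℤ[X]) :
    (reciprocalNumerator e t).comp F =
      ∑ i, C (e i) * ∏ l ∈ univ.erase i, (F + C (t l)) := by
  simp only [reciprocalNumerator, ← coe_compRingHom_apply, map_sum, map_mul, map_prod, map_add]
  simp

theorem reciprocalNumerator_comp_X_sub_C (e t : ι → ℤ) (x : ℤ) :
    (reciprocalNumerator e t).comp (X - C x) = reciprocalNumerator e fun i => t i - x := by
  rw [reciprocalNumerator_comp, reciprocalNumerator]
  simp only [C_sub]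
  refine sum_congr rfl fun i _ => congr_arg _ (prod_congr rfl fun l _ => by ring)

theorem reciprocalNumerator_eval (e t : ι → ℤ) (x : ℤ) :
    (reciprocalNumerator e t).eval x = ∑ i, e i * ∏ l ∈ univ.erase i, (x + t l) := by
  simp [reciprocalNumerator, eval_finsetSum, eval_prod]

theorem reciprocalNumerator_coeff_zero {e t : ι → ℤ} {j : ι} (hj : t j = 0) :
    (reciprocalNumerator e t).coeff 0 = e j * ∏ l ∈ univ.erase j, t l := by
  rw [coeff_zero_eq_eval_zero, reciprocalNumerator_eval]
  simp only [zero_add]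
  refine sum_eq_single j (fun i _ hij => ?_) (by simp)
  rw [prod_eq_zero (mem_erase.2 ⟨hij.symm, mem_univ j⟩) hj, mul_zero]

theorem C_prod_dvd_reciprocalNumerator_comp {e t : ι → ℤ} {j : ι} (hj : t j = 0) {L : ℤ}
    (hL : ∀ l, l ≠ j → t l ∣ L) :
    C (∏ l ∈ univ.erase j, t l) ∣ (reciprocalNumerator e t).comp (C L * X) := by
  rw [reciprocalNumerator_comp]
  have hfac : ∀ l, l ≠ j → C (t l) ∣ C L * X + C (t l) := fun l hl =>
    dvd_add ((map_dvd C (hL l hl)).mul_right _) dvd_rfl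
  refine dvd_sum fun i _ => Dvd.dvd.mul_left ?_ _
  rw [map_prod]
  rcases eq_or_ne i j with rfl | hij
  · exact prod_dvd_prod_of_dvd _ _ fun l hl => hfac l (ne_of_mem_erase hl)
  · rw [← mul_prod_erase (univ.erase j) _ (mem_erase.2 ⟨hij, mem_univ i⟩),
      ← mul_prod_erase (univ.erase i) _ (mem_erase.2 ⟨hij.symm, mem_univ j⟩), erase_right_comm]
    refine mul_dvd_mul ?_ (prod_dvd_prod_of_dvd _ _ fun l hl =>
      hfac l (ne_of_mem_erase hl))
    rw [hj, C_0, add_zero]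
    exact (map_dvd C (hL i hij)).mul_right _

theorem Polynomial.IsPrimitive.comp_X_sub_C {Q : ℤ[X]} (hQ : Q.IsPrimitive) (x : ℤ) :
    (Q.comp (X - C x)).IsPrimitive := by
  intro r hr
  refine hQ r ?_
  obtain ⟨H, hH⟩ := hr
  refine ⟨H.comp (X + C x), ?_⟩
  have := congr_arg (fun F => F.comp (X + C x)) hH
  simpa [comp_assoc] using this

/-- If `Q` is a primitive divisor of the numerator of `∑ i, eᵢ / (X + tᵢ)`, then the value of `Q` at
the pole `-tⱼ` divides a power of any common multiple of the differences `tₗ - tⱼ`. -/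
theorem Polynomial.IsPrimitive.eval_neg_dvd_pow {Q : ℤ[X]} (hQ : Q.IsPrimitive)
    (hdeg : Q.natDegree ≠ 0) {e t : ι → ℤ} (hQP : Q ∣ reciprocalNumerator e t) {j : ι}
    (he : IsUnit (e j)) {L : ℤ} (hL : ∀ l, l ≠ j → t l - t j ∣ L) :
    Q.eval (-t j) ∣ L ^ Q.natDegree := by
  rcases eq_or_ne L 0 with rfl | hL0
  · simp [hdeg]
  have hcoeff := reciprocalNumerator_coeff_zero (e := e) (t := fun i => t i - t j) (j := j)
    (by simp)
  have hdvd := (hQ.comp_X_sub_C (t j)).coeff_zero_dvd_pow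
    (P := reciprocalNumerator e fun i => t i - t j) (L := L) ?_ ?_ ?_
  · rw [natDegree_comp, natDegree_X_sub_C, mul_one, coeff_zero_eq_eval_zero, eval_comp] at hdvd
    simpa using hdvd
  · rw [← reciprocalNumerator_comp_X_sub_C]
    obtain ⟨H, hH⟩ := hQP
    exact ⟨H.comp (X - C (t j)), by rw [hH, mul_comp]⟩
  · rw [hcoeff]
    refine mul_ne_zero he.ne_zero (prod_ne_zero_iff.2 fun l hl h0 => hL0 ?_)
    have := hL l (ne_of_mem_erase hl)
    rwa [h0, zero_dvd_iff] at this
  · rw [hcoeff, C_mul, ((isUnit_C.2 he)).mul_left_dvd]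
    exact C_prod_dvd_reciprocalNumerator_comp (by simp) fun l hl => by simpa using hL l hl

theorem natDegree_reciprocalNumerator_le (e t : ι → ℤ) :
    (reciprocalNumerator e t).natDegree ≤ Fintype.card ι := by
  refine natDegree_sum_le_of_forall_le _ _ fun i _ => (natDegree_C_mul_le _ _).trans ?_
  refine (natDegree_prod_le _ _).trans ?_
  simp only [natDegree_X_add_C, sum_const, smul_eq_mul, mul_one]
  exact card_le_univ _

theorem norm_eval_reciprocalNumerator_le {e t : ι → ℤ} {N : ℕ} (he : ∀ i, |e i| = 1)
    (ht : ∀ i, |t i| ≤ N) (z : ℂ) :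
    ‖((reciprocalNumerator e t).map (Int.castRingHom ℂ)).eval z‖ ≤
      (Fintype.card ι * ((N : ℝ) + 1) ^ Fintype.card ι) * max 1 ‖z‖ ^ Fintype.card ι := by
  have hz : (1 : ℝ) ≤ max 1 ‖z‖ := le_max_left _ _
  have hfac : ∀ l, ‖z + (t l : ℂ)‖ ≤ ((N : ℝ) + 1) * max 1 ‖z‖ := by
    intro l
    have h1 : ‖(t l : ℂ)‖ ≤ N := by
      rw [Complex.norm_intCast]
      exact_mod_cast ht l
    have h2 : ‖z‖ ≤ max 1 ‖z‖ := le_max_right _ _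
    nlinarith [norm_add_le z (t l : ℂ), Nat.cast_nonneg (α := ℝ) N]
  have hterm : ∀ i ∈ univ, ‖(e i : ℂ) * ∏ l ∈ univ.erase i, (z + (t l : ℂ))‖ ≤
      (((N : ℝ) + 1) * max 1 ‖z‖) ^ Fintype.card ι := by
    intro i _
    have h1 : ‖(e i : ℂ)‖ = 1 := by
      rw [Complex.norm_intCast]
      exact_mod_cast he i
    rw [norm_mul, h1, one_mul, norm_prod]
    refine (prod_le_prod (fun _ _ => norm_nonneg _) fun l _ => hfac l).trans ?_
    rw [prod_const]
    refine pow_le_pow_right₀ ?_ (card_le_univ _)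
    nlinarith [Nat.cast_nonneg (α := ℝ) N]
  calc _ = ‖∑ i, (e i : ℂ) * ∏ l ∈ univ.erase i, (z + (t l : ℂ))‖ := by
        simp [reciprocalNumerator, eval_finsetSum, eval_prod, Polynomial.map_sum,
          Polynomial.map_prod]
    _ ≤ ∑ i : ι, (((N : ℝ) + 1) * max 1 ‖z‖) ^ Fintype.card ι := norm_sum_le_of_le _ hterm
    _ = _ := by rw [sum_const, card_univ, nsmul_eq_mul, mul_pow, mul_assoc]

theorem eval_reciprocalNumerator_eq_zero {K : Type*} [Field K] {e t : ι → ℤ} {a : K}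
    (hne : ∀ i, a + (t i : K) ≠ 0) (hsum : ∑ i, (e i : K) * (a + (t i : K))⁻¹ = 0) :
    ((reciprocalNumerator e t).map (Int.castRingHom K)).eval a = 0 := by
  have : ((reciprocalNumerator e t).map (Int.castRingHom K)).eval a =
      (∑ i, (e i : K) * (a + (t i : K))⁻¹) * ∏ i, (a + (t i : K)) := by
    simp only [reciprocalNumerator, eval_finsetSum, Polynomial.map_sum, sum_mul]
    refine sum_congr rfl fun i _ => ?_
    rw [← mul_prod_erase univ _ (mem_univ i), mul_assoc, inv_mul_cancel_left₀ (hne i)]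
    simp [eval_prod, Polynomial.map_prod]
  rw [this, hsum, zero_mul]

end

theorem Polynomial.mahlerMeasure_le_of_forall_norm_eval_le {P : ℂ[X]} {M : ℝ} (hM : 1 ≤ M)
    (h : ∀ z : ℂ, ‖z‖ = 1 → ‖P.eval z‖ ≤ M) : P.mahlerMeasure ≤ M := by
  rcases eq_or_ne P 0 with rfl | hP
  · simpa using zero_le_one.trans hM
  rw [← Real.log_le_log_iff (mahlerMeasure_pos_of_ne_zero hP) (by positivity),
    ← logMahlerMeasure_eq_log_MahlerMeasure, logMahlerMeasure_def,
    ← Real.circleAverage_const (Real.log M) 0 1]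
  refine Real.circleAverage_mono P.intervalIntegrable_mahlerMeasure
    (circleIntegrable_const _ _ _) fun z hz => ?_
  have hz1 : ‖z‖ = 1 := by simpa using hz
  rcases eq_or_ne (P.eval z) 0 with h0 | h0
  · simpa [h0] using Real.log_nonneg hM
  · exact Real.log_le_log (norm_pos_iff.2 h0) (h z hz1)

theorem norm_multiset_prod (s : Multiset ℂ) : ‖s.prod‖ = (s.map fun z => ‖z‖).prod :=
  map_multiset_prod (normHom : ℂ →*₀ ℝ) s

theorem Polynomial.abs_resultant_le {Q P : ℤ[X]} {n : ℕ} {M : ℝ}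
    (hP : P.natDegree ≤ n)
    (hbd : ∀ z : ℂ, ‖(P.map (Int.castRingHom ℂ)).eval z‖ ≤ M * max 1 ‖z‖ ^ n) :
    ((|Q.resultant P Q.natDegree n| : ℤ) : ℝ) ≤
      M ^ Q.natDegree * (Q.map (Int.castRingHom ℂ)).mahlerMeasure ^ n := by
  have hinj := (Int.castRingHom ℂ).injective_int
  have hnd : (Q.map (Int.castRingHom ℂ)).natDegree = Q.natDegree :=
    natDegree_map_eq_of_injective hinj Q
  have hsplit : (Q.map (Int.castRingHom ℂ)).Splits := IsAlgClosed.splits _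
  have hres := resultant_eq_prod_eval (Q.map (Int.castRingHom ℂ)) (P.map (Int.castRingHom ℂ)) n
    (natDegree_map_le.trans hP) hsplit
  rw [resultant_map_map, hnd] at hres
  have hnorm : ((|Q.resultant P Q.natDegree n| : ℤ) : ℝ) =
      ‖(Int.castRingHom ℂ) (Q.resultant P Q.natDegree n)‖ := by simp
  rw [hnorm, hres, norm_mul, norm_pow, mahlerMeasure_eq_leadingCoeff_mul_prod_roots, mul_pow,
    mul_left_comm]
  refine mul_le_mul_of_nonneg_left ?_ (by positivity)
  rw [← hnd, hsplit.natDegree_eq_card_roots, ← Multiset.prod_map_pow,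
    ← Multiset.prod_replicate, ← Multiset.map_const', ← Multiset.prod_map_mul,
    norm_multiset_prod, Multiset.map_map]
  exact Multiset.prod_map_le_prod_map₀ _ _ (fun _ _ => norm_nonneg _) fun α _ => hbd α

theorem Polynomial.dvd_of_common_root_mod {p : ℕ} [Fact p.Prime] {a : ZMod p} {n : ℕ} {M : ℝ}
    (hM : 1 ≤ M) (hp : M ^ (2 * n) < p) {Q : ℤ[X]} (hQ : Irreducible Q) (hQ0 : Q.natDegree ≠ 0)
    (hQn : Q.natDegree ≤ n) (hQM : (Q.map (Int.castRingHom ℂ)).mahlerMeasure ≤ M)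
    (hQa : (Q.map (Int.castRingHom (ZMod p))).eval a = 0) {P : ℤ[X]} (hPn : P.natDegree ≤ n)
    (hPa : (P.map (Int.castRingHom (ZMod p))).eval a = 0)
    (hbd : ∀ z : ℂ, ‖(P.map (Int.castRingHom ℂ)).eval z‖ ≤ M * max 1 ‖z‖ ^ n) : Q ∣ P := by
  have hprim := hQ.isPrimitive hQ0
  by_contra hdvd
  have hinj := (Int.castRingHom ℂ).injective_int
  have hcop : IsCoprime (Q.map (Int.castRingHom ℚ)) (P.map (Int.castRingHom ℚ)) := by
    rw [((IsPrimitive.Int.irreducible_iff_irreducible_map_cast hprim).1 hQ).coprime_iff_not_dvd]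
    rwa [← IsPrimitive.Int.dvd_iff_map_cast_dvd_map_cast _ _ hprim]
  have hcop' : IsCoprime (Q.map (Int.castRingHom ℂ)) (P.map (Int.castRingHom ℂ)) := by
    have := hcop.map (mapRingHom (algebraMap ℚ ℂ))
    simpa only [coe_mapRingHom, Polynomial.map_map, RingHom.ext_int _ (Int.castRingHom ℂ)]
      using this
  have hr0 : Q.resultant P Q.natDegree n ≠ 0 := by
    intro h0
    have hres := resultant_eq_prod_eval (Q.map (Int.castRingHom ℂ)) (P.map (Int.castRingHom ℂ)) n
      (natDegree_map_le.trans hPn) (IsAlgClosed.splits _)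
    rw [resultant_map_map, natDegree_map_eq_of_injective hinj Q, h0, map_zero, eq_comm,
      mul_eq_zero, Multiset.prod_eq_zero_iff] at hres
    rcases hres with h | h
    · have := leadingCoeff_eq_zero.1 (eq_zero_of_pow_eq_zero h)
      exact hQ.ne_zero (map_injective _ hinj (by simpa using this))
    · obtain ⟨α, hα, hPα⟩ := Multiset.mem_map.1 h
      obtain ⟨U, V, hUV⟩ := hcop'
      have := congr_arg (eval α) hUV
      simp [hPα, (isRoot_of_mem_roots hα).eq_zero] at this
  have hpr : (p : ℤ) ∣ Q.resultant P Q.natDegree n := by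
    obtain ⟨U, V, -, -, h⟩ := exists_mul_add_mul_eq_C_resultant (m := Q.natDegree) (n := n) Q P
      le_rfl hPn (Or.inl hQ0)
    rw [← ZMod.intCast_zmod_eq_zero_iff_dvd]
    have := congr_arg (fun F => (F.map (Int.castRingHom (ZMod p))).eval a) h
    simpa [hQa, hPa, eq_comm] using this
  have h1 : ((p : ℤ) : ℝ) ≤ ((|Q.resultant P Q.natDegree n| : ℤ) : ℝ) := by
    exact_mod_cast Int.le_of_dvd (abs_pos.2 hr0) ((dvd_abs _ _).2 hpr)
  have h2 := abs_resultant_le (Q := Q) hPn hbd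
  have h3 : M ^ Q.natDegree * (Q.map (Int.castRingHom ℂ)).mahlerMeasure ^ n ≤ M ^ (2 * n) := by
    rw [two_mul, pow_add]
    gcongr
    · exact pow_nonneg (mahlerMeasure_nonneg _) _
    · exact mahlerMeasure_nonneg _
  push_cast at h1 h2
  linarith

theorem Polynomial.exists_primitive_common_divisor {p : ℕ} [Fact p.Prime] {a : ZMod p} {n N : ℕ}
    (hn : n ≠ 0) {M : ℝ} (hM : 1 ≤ M) (hp : M ^ (2 * n) < p)
    (ha : ∀ x ∈ Icc (1 : ℤ) N, a + (x : ZMod p) ≠ 0) (S : Set ℤ[X])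
    (hSn : ∀ P ∈ S, P.natDegree ≤ n)
    (hSa : ∀ P ∈ S, (P.map (Int.castRingHom (ZMod p))).eval a = 0)
    (hbd : ∀ P ∈ S, ∀ z : ℂ, ‖(P.map (Int.castRingHom ℂ)).eval z‖ ≤ M * max 1 ‖z‖ ^ n) :
    ∃ Q : ℤ[X], Q.IsPrimitive ∧ Q.natDegree ≠ 0 ∧ Q.natDegree ≤ n ∧
      (Q.map (Int.castRingHom ℂ)).mahlerMeasure ≤ M ∧ (∀ x ∈ Icc (1 : ℤ) N, Q.eval (-x) ≠ 0) ∧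
      ∀ P ∈ S, Q ∣ P := by
  by_cases hS : ∀ P ∈ S, P = 0
  · refine ⟨X, monic_X.isPrimitive, by simp, by simp; omega, by simpa [mahlerMeasure] using hM,
      fun x hx => ?_, fun P hP => by simp [hS P hP]⟩
    have := (Finset.mem_Icc.1 hx).1
    simp
    omega
  push Not at hS
  obtain ⟨P, hPS, hP0⟩ := hS
  obtain ⟨s, hs, hsP⟩ := WfDvdMonoid.exists_factors P hP0
  have hprod : ((s.prod).map (Int.castRingHom (ZMod p))).eval a = 0 := by
    obtain ⟨R, hR⟩ := hsP.symm.dvd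
    rw [hR, Polynomial.map_mul, eval_mul, hSa P hPS, zero_mul]
  obtain ⟨Q, hQs, hQa⟩ : ∃ Q ∈ s, (Q.map (Int.castRingHom (ZMod p))).eval a = 0 := by
    rw [← coe_mapRingHom, ← coe_evalRingHom, ← RingHom.comp_apply, map_multiset_prod,
      Multiset.prod_eq_zero_iff, Multiset.mem_map] at hprod
    exact hprod
  have hQ := hs Q hQs
  have hQP : Q ∣ P := (Multiset.dvd_prod hQs).trans hsP.dvd
  have hPM : (P.map (Int.castRingHom ℂ)).mahlerMeasure ≤ M :=
    mahlerMeasure_le_of_forall_norm_eval_le hM fun z hz => by simpa [hz] using hbd P hPS z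
  have hQM : (Q.map (Int.castRingHom ℂ)).mahlerMeasure ≤ M := by
    obtain ⟨R, hR⟩ := hQP
    have hR0 : R ≠ 0 := by
      rintro rfl
      simp_all
    refine le_trans ?_ hPM
    rw [hR, Polynomial.map_mul, mahlerMeasure_mul]
    exact le_mul_of_one_le_right (mahlerMeasure_nonneg _) (one_le_mahlerMeasure_of_ne_zero hR0)
  have hQ0 : Q.natDegree ≠ 0 := by
    intro h0
    obtain ⟨q, rfl⟩ := natDegree_eq_zero.1 h0
    have hq0 : q ≠ 0 := by
      rintro rfl
      simpa using hQ.ne_zero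
    rw [map_C, eval_C, eq_intCast, ZMod.intCast_zmod_eq_zero_iff_dvd] at hQa
    have h1 : ((p : ℤ) : ℝ) ≤ ((|q| : ℤ) : ℝ) := by
      exact_mod_cast Int.le_of_dvd (abs_pos.2 hq0) ((dvd_abs _ _).2 hQa)
    have h2 : ((|q| : ℤ) : ℝ) ≤ M := by
      rw [map_C, mahlerMeasure_const] at hQM
      simpa using hQM
    have h3 : M ≤ M ^ (2 * n) := le_self_pow₀ hM (by omega)
    push_cast at h1 h2
    linarith
  refine ⟨Q, hQ.isPrimitive hQ0, hQ0, (natDegree_le_of_dvd hQP hP0).trans (hSn P hPS), hQM,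
    fun x hx h0 => ?_, fun P' hP' => dvd_of_common_root_mod hM hp hQ hQ0
      ((natDegree_le_of_dvd hQP hP0).trans (hSn P hPS)) hQM hQa (hSn P' hP') (hSa P' hP')
      (hbd P' hP')⟩
  have hdvd : X - C (-x) ∣ Q := dvd_iff_isRoot.2 h0
  have hassoc : Q ∣ X - C (-x) := (hQ.dvd_iff.1 hdvd).resolve_left (not_isUnit_X_sub_C _) |>.dvd
  obtain ⟨R, hR⟩ := hassoc
  have := congr_arg (fun F => (F.map (Int.castRingHom (ZMod p))).eval a) hR
  simp [hQa] at this
  exact ha x hx this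

theorem Polynomial.abs_eval_neg_le {Q : ℤ[X]} {N : ℕ} {x : ℤ} (hx : |x| ≤ N) :
    ((|Q.eval (-x)| : ℤ) : ℝ) ≤
      ((N : ℝ) + 1) ^ Q.natDegree * (Q.map (Int.castRingHom ℂ)).mahlerMeasure := by
  have hnd : (Q.map (Int.castRingHom ℂ)).natDegree = Q.natDegree :=
    natDegree_map_eq_of_injective (Int.castRingHom ℂ).injective_int Q
  have hsplit : (Q.map (Int.castRingHom ℂ)).Splits := IsAlgClosed.splits _
  have hnorm : ((|Q.eval (-x)| : ℤ) : ℝ) = ‖(Q.map (Int.castRingHom ℂ)).eval (-(x : ℂ))‖ := by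
    have : (Q.map (Int.castRingHom ℂ)).eval (-(x : ℂ)) = ((Q.eval (-x) : ℤ) : ℂ) := by
      simpa using eval_intCast_map (Int.castRingHom ℂ) Q (-x)
    rw [this]
    simp
  have hx' : ‖(x : ℂ)‖ ≤ N := by
    rw [Complex.norm_intCast]
    exact_mod_cast hx
  rw [hnorm, hsplit.eval_eq_prod_roots, norm_mul, mahlerMeasure_eq_leadingCoeff_mul_prod_roots,
    mul_left_comm]
  refine mul_le_mul_of_nonneg_left ?_ (norm_nonneg _)
  rw [← hnd, hsplit.natDegree_eq_card_roots, ← Multiset.prod_replicate, ← Multiset.map_const',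
    ← Multiset.prod_map_mul, norm_multiset_prod, Multiset.map_map]
  refine Multiset.prod_map_le_prod_map₀ _ _ (fun _ _ => norm_nonneg _) fun α _ => ?_
  have h1 : ‖α‖ ≤ max 1 ‖α‖ := le_max_right _ _
  have h2 : 1 ≤ max 1 ‖α‖ := le_max_left _ _
  have h3 := norm_sub_le (-(x : ℂ)) α
  rw [norm_neg] at h3
  simp only [Function.comp_apply]
  nlinarith [Nat.cast_nonneg (α := ℝ) N]

/-- If the value of `Q` at `-x` divides `m ^ deg Q`, then `-x` lies within `m` of
the real part of some complex root of `Q`. -/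
theorem Polynomial.exists_root_re_add_le {Q : ℤ[X]} (hQ : Q.natDegree ≠ 0) {x : ℤ} {m : ℕ}
    (hm : m ≠ 0) (hdvd : Q.eval (-x) ∣ (m : ℤ) ^ Q.natDegree) :
    ∃ α ∈ (Q.map (Int.castRingHom ℂ)).roots, |(x : ℝ) + α.re| ≤ m := by
  have hinj := (Int.castRingHom ℂ).injective_int
  have hnd : (Q.map (Int.castRingHom ℂ)).natDegree = Q.natDegree :=
    natDegree_map_eq_of_injective hinj Q
  have hsplit : (Q.map (Int.castRingHom ℂ)).Splits := IsAlgClosed.splits _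
  have hne : (Q.map (Int.castRingHom ℂ)).roots.toFinset.Nonempty := by
    obtain ⟨α, hα⟩ := Multiset.card_pos_iff_exists_mem.1
      (hsplit.natDegree_eq_card_roots ▸ hnd ▸ Nat.pos_of_ne_zero hQ)
    exact ⟨α, Multiset.mem_toFinset.2 hα⟩
  obtain ⟨α, hα, hmin⟩ := exists_min_image _ (fun α : ℂ => |(x : ℝ) + α.re|) hne
  refine ⟨α, Multiset.mem_toFinset.1 hα, ?_⟩
  have hnorm : ((|Q.eval (-x)| : ℤ) : ℝ) = ‖(Q.map (Int.castRingHom ℂ)).eval (-(x : ℂ))‖ := by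
    have : (Q.map (Int.castRingHom ℂ)).eval (-(x : ℂ)) = ((Q.eval (-x) : ℤ) : ℂ) := by
      simpa using eval_intCast_map (Int.castRingHom ℂ) Q (-x)
    rw [this]
    simp
  have hupper : ((|Q.eval (-x)| : ℤ) : ℝ) ≤ (m : ℝ) ^ Q.natDegree := by
    exact_mod_cast Int.le_of_dvd (by positivity) ((abs_dvd _ _).2 hdvd)
  have hlead : 1 ≤ ‖(Q.map (Int.castRingHom ℂ)).leadingCoeff‖ := by
    rw [leadingCoeff_map_of_injective hinj, eq_intCast, Complex.norm_intCast]
    exact_mod_cast Int.one_le_abs (leadingCoeff_ne_zero.2 fun h => hQ (by simp [h]))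
  have hlower : |(x : ℝ) + α.re| ^ Q.natDegree ≤ ((|Q.eval (-x)| : ℤ) : ℝ) := by
    rw [hnorm, hsplit.eval_eq_prod_roots, norm_mul, norm_multiset_prod, Multiset.map_map]
    refine le_trans ?_ (le_mul_of_one_le_left (Multiset.prod_nonneg ?_) hlead)
    · rw [← hnd, hsplit.natDegree_eq_card_roots, ← Multiset.prod_replicate, ← Multiset.map_const']
      refine Multiset.prod_map_le_prod_map₀ _ _ (fun _ _ => abs_nonneg _) fun β hβ => ?_
      refine (hmin β (Multiset.mem_toFinset.2 hβ)).trans ?_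
      have := Complex.abs_re_le_norm (-(x : ℂ) - β)
      rw [Complex.sub_re, Complex.neg_re, Complex.intCast_re, ← abs_neg] at this
      simpa [add_comm] using this
    · intro r hr
      obtain ⟨β, -, rfl⟩ := Multiset.mem_map.1 hr
      exact norm_nonneg _
  exact (pow_le_pow_iff_left₀ (abs_nonneg _) (Nat.cast_nonneg m) hQ).1 (hlower.trans hupper)

theorem sum_inv_abs_sub_div_add_one_le_of_le {S : Finset ℤ} {N a : ℕ} (ha : a ≠ 0)
    (hN : ∀ x ∈ S, ∀ y ∈ S, x - y < N) (hS : ∀ x ∈ S, ∀ y ∈ S, (a : ℤ) ∣ x - y) {ρ : ℝ}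
    (hρ : ∀ x ∈ S, ρ ≤ x) :
    ∑ x ∈ S, (|(x : ℝ) - ρ| / a + 1)⁻¹ ≤ 1 + Real.log N := by
  rcases S.eq_empty_or_nonempty with rfl | hne
  · simpa using add_nonneg zero_le_one (Real.log_natCast_nonneg N)
  obtain ⟨x₀, hx₀, hmin⟩ := exists_min_image S id hne
  simp only [id] at hmin
  have ha' : (0 : ℝ) < a := by positivity
  choose! q hq using fun x hx => hS x hx x₀ hx₀
  have hq0 : ∀ x ∈ S, 0 ≤ q x := fun x hx => by
    have h1 := hmin x hx
    have h2 := hq x hx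
    have h3 : (0 : ℤ) < a := by positivity
    by_contra! h4
    nlinarith
  have hqN : ∀ x ∈ S, q x < N := fun x hx => by
    have h1 := hN x hx x₀ hx₀
    have h2 := hq x hx
    have h3 : (1 : ℤ) ≤ a := by exact_mod_cast Nat.one_le_iff_ne_zero.2 ha
    nlinarith [hq0 x hx]
  have hinj : Set.InjOn (fun x => (q x).toNat) (S : Set ℤ) := fun x hx y hy hxy => by
    have h1 : q x = q y := by
      have := hq0 x hx
      have := hq0 y hy
      simp only at hxy
      omega
    have h2 := hq x hx
    have h3 := hq y hy
    rw [h1] at h2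
    linarith
  calc ∑ x ∈ S, (|(x : ℝ) - ρ| / a + 1)⁻¹ ≤ ∑ x ∈ S, (((q x).toNat : ℝ) + 1)⁻¹ := by
        refine sum_le_sum fun x hx => ?_
        have h1 : ((q x).toNat : ℝ) = q x := by exact_mod_cast Int.toNat_of_nonneg (hq0 x hx)
        have h2 : (x : ℝ) - x₀ = a * q x := by exact_mod_cast hq x hx
        gcongr
        rw [h1, le_div_iff₀ ha', abs_of_nonneg (sub_nonneg.2 (hρ x hx))]
        linarith [hρ x₀ hx₀]
    _ = ∑ i ∈ S.image (fun x => (q x).toNat), ((i : ℝ) + 1)⁻¹ :=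
        (sum_image (f := fun i : ℕ => ((i : ℝ) + 1)⁻¹) hinj).symm
    _ ≤ ∑ i ∈ range N, ((i : ℝ) + 1)⁻¹ := by
        refine sum_le_sum_of_subset_of_nonneg (fun i hi => ?_) fun _ _ _ => by positivity
        obtain ⟨x, hx, rfl⟩ := mem_image.1 hi
        have := hqN x hx
        have := hq0 x hx
        rw [mem_range]
        omega
    _ = (harmonic N : ℝ) := by simp [harmonic]
    _ ≤ 1 + Real.log N := harmonic_le_one_add_log N

theorem sum_inv_abs_sub_div_add_one_le {S : Finset ℤ} {N a : ℕ} (ha : a ≠ 0)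
    (hN : ∀ x ∈ S, ∀ y ∈ S, x - y < N) (hS : ∀ x ∈ S, ∀ y ∈ S, (a : ℤ) ∣ x - y) (ρ : ℝ) :
    ∑ x ∈ S, (|(x : ℝ) - ρ| / a + 1)⁻¹ ≤ 2 * (1 + Real.log N) := by
  rw [← sum_filter_add_sum_filter_not S (fun x : ℤ => ρ ≤ x), two_mul]
  refine add_le_add ?_ ?_
  · refine sum_inv_abs_sub_div_add_one_le_of_le ha (fun x hx y hy => ?_) (fun x hx y hy => ?_)
      fun x hx => (mem_filter.1 hx).2
    · exact hN x (mem_filter.1 hx).1 y (mem_filter.1 hy).1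
    · exact hS x (mem_filter.1 hx).1 y (mem_filter.1 hy).1
  · set U := S.filter fun x : ℤ => ¬ρ ≤ x with hU
    have hUS : ∀ x ∈ U, x ∈ S := fun x hx => (mem_filter.1 hx).1
    have := sum_inv_abs_sub_div_add_one_le_of_le (S := U.image fun x => -x) (ρ := -ρ) (N := N) ha
      ?_ ?_ ?_
    · rw [sum_image fun x _ y _ h => neg_injective h] at this
      refine le_of_eq_of_le (sum_congr rfl fun x _ => ?_) this
      push_cast
      rw [← abs_neg]
      ring_nf
    · simp only [forall_mem_image]
      intro x hx y hy
      have := hN y (hUS y hy) x (hUS x hx)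
      linarith
    · simp only [forall_mem_image]
      intro x hx y hy
      have := hS y (hUS y hy) x (hUS x hx)
      rwa [show -x - -y = y - x by ring]
    · simp only [forall_mem_image]
      intro x hx
      have := not_le.1 (mem_filter.1 hx).2
      push_cast
      linarith

/-- A weight on the integers `x`, comparable to `a / (a + r)` where `r` is the distance from `x` to
the set of centres `R`. -/
noncomputable def centredWeight (R : Finset ℝ) (a : ℕ) (x : ℤ) : ℝ :=
  ∑ ρ ∈ R, (|(x : ℝ) - ρ| / a + 1)⁻¹

theorem centredWeight_nonneg (R : Finset ℝ) (a : ℕ) (x : ℤ) : 0 ≤ centredWeight R a x :=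
  sum_nonneg fun _ _ => by positivity

theorem sum_centredWeight_le {S : Finset ℤ} {N a : ℕ} (ha : a ≠ 0)
    (hN : ∀ x ∈ S, ∀ y ∈ S, x - y < N) (hS : ∀ x ∈ S, ∀ y ∈ S, (a : ℤ) ∣ x - y) (R : Finset ℝ) :
    ∑ x ∈ S, centredWeight R a x ≤ #R * (2 * (1 + Real.log N)) := by
  simp only [centredWeight]
  rw [sum_comm, ← nsmul_eq_mul]
  exact sum_le_card_nsmul _ _ _ fun ρ _ => sum_inv_abs_sub_div_add_one_le ha hN hS ρ

theorem one_le_mul_centredWeight_mul_centredWeight {R : Finset ℝ} {N a b : ℕ} {x : ℤ}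
    (hN : N ≠ 0) (ha : a ≠ 0) (hb : b ≠ 0) {ρ : ℝ} (hρ : ρ ∈ R) (hρN : |(x : ℝ) - ρ| ≤ N)
    (hρab : |(x : ℝ) - ρ| ≤ a * b) :
    1 ≤ 4 * N * (centredWeight R a x * centredWeight R b x) := by
  have hle : ∀ c : ℕ, (|(x : ℝ) - ρ| / c + 1)⁻¹ ≤ centredWeight R c x := fun c =>
    single_le_sum (f := fun ρ : ℝ => (|(x : ℝ) - ρ| / c + 1)⁻¹) (fun _ _ => by positivity) hρ
  have ha' : (1 : ℝ) ≤ a := by exact_mod_cast Nat.one_le_iff_ne_zero.2 ha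
  have hb' : (1 : ℝ) ≤ b := by exact_mod_cast Nat.one_le_iff_ne_zero.2 hb
  have hN' : (1 : ℝ) ≤ N := by exact_mod_cast Nat.one_le_iff_ne_zero.2 hN
  set r := |(x : ℝ) - ρ| with hr
  have hr0 : 0 ≤ r := abs_nonneg _
  have h1 : r / a ≤ N := (div_le_self hr0 ha').trans hρN
  have h2 : r / b ≤ N := (div_le_self hr0 hb').trans hρN
  have h3 : r / a * (r / b) ≤ N := by
    rw [div_mul_div_comm, div_le_iff₀ (by positivity)]
    exact mul_le_mul hρN hρab hr0 (by positivity)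
  calc (1 : ℝ) ≤ 4 * N * ((r / a + 1)⁻¹ * (r / b + 1)⁻¹) := by
        rw [← mul_inv, ← div_eq_mul_inv, one_le_div (by positivity)]
        nlinarith
    _ ≤ _ := by
        gcongr
        · exact centredWeight_nonneg _ _ _
        · exact hle a
        · exact hle b

/-- The least common multiple of the common divisors of `f x` and `x - y` for `y ∈ S`. -/
def sharedModulus (f : ℤ → ℤ) (S : Finset ℤ) (x : ℤ) : ℕ :=
  S.lcm fun y => Int.gcd (f x) (x - y)

theorem sharedModulus_ne_zero {f : ℤ → ℤ} {S : Finset ℤ} {x : ℤ} (hx : f x ≠ 0) :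
    sharedModulus f S x ≠ 0 := by
  rw [sharedModulus, Ne, Finset.lcm_eq_zero_iff]
  simp [Int.gcd_eq_zero_iff, hx]

theorem sum_centredWeight_sharedModulus_le {f : ℤ → ℤ} (hf : ∀ x y, x - y ∣ f x - f y) {N n : ℕ}
    (hf0 : ∀ x ∈ Icc (1 : ℤ) N, f x ≠ 0) {T : ℝ} (hT1 : 1 ≤ T)
    (hT : ∀ x ∈ Icc (1 : ℤ) N, (#(f x).natAbs.divisors : ℝ) ≤ T) (R : Finset ℝ) {S : Finset ℤ}
    (hS : S ⊆ Icc (1 : ℤ) N) (hSn : #S ≤ n) :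
    ∑ x ∈ Icc (1 : ℤ) N, centredWeight R (sharedModulus f S x) x ≤
      T ^ n * (#R * (2 * (1 + Real.log N))) := by
  have hmaps : ∀ x ∈ Icc (1 : ℤ) N, (fun y (_ : y ∈ S) => Int.gcd (f x) (x - y)) ∈
      S.pi fun y => (f y).natAbs.divisors := by
    intro x _
    rw [Finset.mem_pi]
    intro y hy
    rw [Nat.mem_divisors]
    refine ⟨?_, Int.natAbs_ne_zero.2 (hf0 y (hS hy))⟩
    rw [← Int.natCast_dvd]
    have h1 : ((Int.gcd (f x) (x - y) : ℕ) : ℤ) ∣ f x - f y :=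
      (Int.gcd_dvd_right _ _).trans (hf x y)
    exact (dvd_sub_right (Int.gcd_dvd_left _ _)).1 h1
  rw [← sum_fiberwise_of_maps_to hmaps]
  have hfib : ∀ d ∈ S.pi fun y => (f y).natAbs.divisors,
      ∑ x ∈ Icc (1 : ℤ) N with (fun y (_ : y ∈ S) => Int.gcd (f x) (x - y)) = d,
        centredWeight R (sharedModulus f S x) x ≤ #R * (2 * (1 + Real.log N)) := by
    intro d _
    set F := (Icc (1 : ℤ) N).filter
      fun x => (fun y (_ : y ∈ S) => Int.gcd (f x) (x - y)) = d with hF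
    rcases F.eq_empty_or_nonempty with h0 | ⟨x₀, hx₀⟩
    · rw [h0, sum_empty]
      have := Real.log_natCast_nonneg N
      positivity
    have hgcd : ∀ x ∈ F, ∀ y ∈ S, Int.gcd (f x) (x - y) = Int.gcd (f x₀) (x₀ - y) := by
      intro x hx y hy
      exact congr_fun₂ ((mem_filter.1 hx).2.trans (mem_filter.1 hx₀).2.symm) y hy
    have hmod : ∀ x ∈ F, sharedModulus f S x = sharedModulus f S x₀ := fun x hx =>
      Finset.lcm_congr rfl (hgcd x hx)
    rw [sum_congr rfl fun x hx => by rw [hmod x hx]]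
    refine sum_centredWeight_le (sharedModulus_ne_zero (hf0 x₀ (mem_filter.1 hx₀).1))
      (fun x hx y hy => ?_) (fun x hx y hy => ?_) R
    · have := mem_Icc.1 (mem_filter.1 hx).1
      have := mem_Icc.1 (mem_filter.1 hy).1
      omega
    · rw [Int.natCast_dvd]
      refine Finset.lcm_dvd fun z hz => ?_
      rw [← Int.natCast_dvd, ← sub_sub_sub_cancel_right x y z]
      refine dvd_sub ?_ ?_
      · rw [← hgcd x hx z hz]
        exact Int.gcd_dvd_right _ _
      · rw [← hgcd y hy z hz]
        exact Int.gcd_dvd_right _ _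
  refine (sum_le_card_nsmul _ _ _ hfib).trans ?_
  rw [nsmul_eq_mul]
  have hlog := Real.log_natCast_nonneg N
  gcongr
  rw [card_pi, Nat.cast_prod]
  calc ∏ y ∈ S, (#(f y).natAbs.divisors : ℝ) ≤ ∏ y ∈ S, T :=
        prod_le_prod (fun _ _ => Nat.cast_nonneg _) fun y hy => hT y (hS hy)
    _ = T ^ #S := prod_const _
    _ ≤ T ^ n := pow_le_pow_right₀ hT1 hSn

theorem Fintype.sum_piFinset_fin_succ {α M : Type*} [AddCommMonoid M] {m : ℕ} (X : Finset α)
    (F : (Fin (m + 1) → α) → M) :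
    ∑ t ∈ Fintype.piFinset fun _ : Fin (m + 1) => X, F t =
      ∑ u ∈ Fintype.piFinset fun _ : Fin m => X, ∑ x ∈ X, F (Fin.cons x u) := by
  rw [← sum_product']
  refine sum_nbij' (fun t => (Fin.tail t, t 0)) (fun q => Fin.cons q.2 q.1) ?_ ?_ ?_ ?_ ?_
  · simp +contextual [Fin.tail]
  · simp +contextual [Fin.forall_fin_succ]
  · simp
  · simp
  · simp

theorem sum_piFinset_prod_Ioi_le {X : Finset ℤ} {g : Finset ℤ → ℤ → ℝ} {B : ℝ}
    (hB : 0 ≤ B) (hg : ∀ S x, 0 ≤ g S x) (m n : ℕ) (hm : m ≤ n)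
    (h : ∀ S ⊆ X, #S ≤ n → ∑ x ∈ X, g S x ≤ B) :
    ∑ t ∈ Fintype.piFinset fun _ : Fin m => X, ∏ j, g ((Ioi j).image t) (t j) ≤ B ^ m := by
  induction m with
  | zero => simp
  | succ m ih =>
    rw [Fintype.sum_piFinset_fin_succ, pow_succ]
    refine le_trans (sum_le_sum fun u hu => ?_)
      ((sum_mul _ _ _).symm.trans_le (mul_le_mul_of_nonneg_right (ih (by omega)) hB))
    rw [Fintype.mem_piFinset] at hu
    have himage : ∀ x, ∏ j, g ((Ioi j).image (Fin.cons x u : Fin (m + 1) → ℤ))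
        ((Fin.cons x u : Fin (m + 1) → ℤ) j) =
          (∏ j, g ((Ioi j).image u) (u j)) * g (univ.image u) x := by
      intro x
      rw [Fin.prod_univ_succ, mul_comm]
      congr 1
      · refine prod_congr rfl fun j _ => ?_
        rw [← Fin.map_succEmb_Ioi, map_eq_image, image_image]
        rfl
      · rw [Fin.Ioi_zero_eq_map, map_eq_image, image_image]
        rfl
    simp only [himage, ← mul_sum]
    refine mul_le_mul_of_nonneg_left (h _ ?_ ?_) (prod_nonneg fun _ _ => hg _ _)
    · exact image_subset_iff.2 fun j _ => hu j
    · exact card_image_le.trans (by simp; omega)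

theorem sum_piFinset_prod_Iio_le {X : Finset ℤ} {g : Finset ℤ → ℤ → ℝ} {B : ℝ}
    (hB : 0 ≤ B) (hg : ∀ S x, 0 ≤ g S x) (n : ℕ)
    (h : ∀ S ⊆ X, #S ≤ n → ∑ x ∈ X, g S x ≤ B) :
    ∑ t ∈ Fintype.piFinset fun _ : Fin n => X, ∏ j, g ((Iio j).image t) (t j) ≤ B ^ n := by
  refine le_of_eq_of_le ?_ (sum_piFinset_prod_Ioi_le hB hg n n le_rfl h)
  refine sum_nbij' (fun t => t ∘ Fin.rev) (fun t => t ∘ Fin.rev) ?_ ?_ ?_ ?_ ?_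
  · intro t ht
    rw [Fintype.mem_piFinset] at ht ⊢
    exact fun j => ht _
  · intro t ht
    rw [Fintype.mem_piFinset] at ht ⊢
    exact fun j => ht _
  · intro t _
    ext j
    simp
  · intro t _
    ext j
    simp
  · intro t _
    rw [← Equiv.prod_comp Fin.revPerm]
    refine prod_congr rfl fun j _ => ?_
    rw [← image_image]
    simp

theorem dvd_sharedModulus_mul_pow {f : ℤ → ℤ} {S S' : Finset ℤ} {x : ℤ} {d : ℕ} (hd : d ≠ 0)
    (h : ∀ L : ℤ, (∀ y ∈ S, y - x ∣ L) → (∀ y ∈ S', y - x ∣ L) → f x ∣ L ^ d) :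
    f x ∣ ((sharedModulus f S x * sharedModulus f S' x : ℕ) : ℤ) ^ d := by
  set F : Finset ℤ → ℕ := fun U => U.lcm fun y => (x - y).natAbs with hF
  have hFdvd : ∀ U, ∀ y ∈ U, y - x ∣ ((F U : ℕ) : ℤ) := fun U y hy => by
    rw [← neg_dvd, neg_sub, Int.dvd_natCast]
    exact Finset.dvd_lcm (f := fun y => (x - y).natAbs) hy
  have hmod : ∀ U, (f x).natAbs.gcd (F U) ∣ sharedModulus f U x := fun U =>
    Nat.gcd_finsetLcm_dvd _ _ _
  have h1 := h ((F S * F S' : ℕ) : ℤ) (fun y hy => ?_) fun y hy => ?_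
  · rw [← Nat.cast_pow, Int.dvd_natCast] at h1 ⊢
    calc (f x).natAbs ∣ ((f x).natAbs ^ d).gcd ((F S * F S') ^ d) :=
          Nat.dvd_gcd (dvd_pow_self _ hd) h1
      _ = (f x).natAbs.gcd (F S * F S') ^ d := Nat.pow_gcd_pow
      _ ∣ _ := pow_dvd_pow_of_dvd ((Nat.gcd_mul_right_dvd_mul_gcd _ _ _).trans
          (mul_dvd_mul (hmod S) (hmod S'))) d
  · rw [Nat.cast_mul]
    exact (hFdvd S y hy).mul_right _
  · rw [Nat.cast_mul]
    exact (hFdvd S' y hy).mul_left _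

/-- The set of centres attached to `Q`: the point `1` and the negatives of the real parts of the
complex roots of `Q`. -/
noncomputable def rootCentres (Q : ℤ[X]) : Finset ℝ :=
  insert 1 ((Q.map (Int.castRingHom ℂ)).roots.toFinset.image fun α => -α.re)

theorem card_rootCentres_le (Q : ℤ[X]) : #(rootCentres Q) ≤ Q.natDegree + 1 := by
  refine (card_insert_le _ _).trans (Nat.succ_le_succ (card_image_le.trans ?_))
  exact (Multiset.toFinset_card_le _).trans ((card_roots' _).trans natDegree_map_le)

theorem exists_mem_rootCentres {Q : ℤ[X]} (hQ : Q.natDegree ≠ 0) {N m : ℕ} {x : ℤ}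
    (hx : x ∈ Icc (1 : ℤ) N) (hm : m ≠ 0) (hdvd : Q.eval (-x) ∣ (m : ℤ) ^ Q.natDegree) :
    ∃ ρ ∈ rootCentres Q, |(x : ℝ) - ρ| ≤ N ∧ |(x : ℝ) - ρ| ≤ m := by
  obtain ⟨α, hα, hle⟩ := exists_root_re_add_le hQ hm hdvd
  by_cases hN : |(x : ℝ) + α.re| ≤ N
  · refine ⟨-α.re, ?_, by simpa using hN, by simpa using hle⟩
    exact mem_insert_of_mem (mem_image_of_mem _ (Multiset.mem_toFinset.2 hα))
  · have h1 : |(x : ℝ) - 1| ≤ N := by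
      obtain ⟨hx1, hxN⟩ := mem_Icc.1 hx
      have hx1' : (1 : ℝ) ≤ x := by exact_mod_cast hx1
      have hxN' : (x : ℝ) ≤ N := by exact_mod_cast hxN
      rw [abs_of_nonneg (by linarith)]
      linarith
    exact ⟨1, mem_insert_self _ _, h1, by linarith⟩

theorem card_le_of_eval_neg_dvd_pow {Q : ℤ[X]} (hQ : Q.natDegree ≠ 0) {k N : ℕ} (hN : N ≠ 0)
    (hQd : Q.natDegree ≤ k + k) (hQ0 : ∀ x ∈ Icc (1 : ℤ) N, Q.eval (-x) ≠ 0) {T : ℝ} (hT1 : 1 ≤ T)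
    (hT : ∀ x ∈ Icc (1 : ℤ) N, (#(Q.eval (-x)).natAbs.divisors : ℝ) ≤ T)
    {U : Finset (Fin (k + k) → ℤ)} (hU : U ⊆ Fintype.piFinset fun _ => Icc (1 : ℤ) N)
    (hdvd : ∀ t ∈ U, ∀ j, ∀ L : ℤ, (∀ l, l ≠ j → t l - t j ∣ L) →
      Q.eval (-t j) ∣ L ^ Q.natDegree) :
    (#U : ℝ) ≤ 2 * (4 * N) ^ k *
      (T ^ (k + k) * (((k + k : ℕ) + 1) * (2 * (1 + Real.log N)))) ^ (k + k) := by
  set f : ℤ → ℤ := fun x => Q.eval (-x) with hf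
  set R := rootCentres Q
  set B := T ^ (k + k) * (((k + k : ℕ) + 1) * (2 * (1 + Real.log N))) with hBdef
  set g : Finset ℤ → ℤ → ℝ := fun S x => centredWeight R (sharedModulus f S x) x with hg
  have hlog := Real.log_natCast_nonneg N
  have hB : 0 ≤ B := by positivity
  have hg0 : ∀ S x, 0 ≤ g S x := fun S x => centredWeight_nonneg _ _ _
  have hfdvd : ∀ x y, x - y ∣ f x - f y := fun x y => by
    have := sub_dvd_eval_sub (-x) (-y) Q
    rwa [neg_sub_neg, ← neg_dvd, neg_sub] at this
  have hsum : ∀ S ⊆ Icc (1 : ℤ) N, #S ≤ k + k → ∑ x ∈ Icc (1 : ℤ) N, g S x ≤ B := by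
    intro S hS hSn
    refine (sum_centredWeight_sharedModulus_le hfdvd hQ0 hT1 hT R hS hSn).trans ?_
    have hR : (#R : ℝ) ≤ (k + k : ℕ) + 1 := by
      exact_mod_cast (card_rootCentres_le Q).trans (Nat.succ_le_succ hQd)
    rw [hBdef]
    gcongr
  have hpoint : ∀ t ∈ U, (1 : ℝ) ≤ (4 * N) ^ k *
      (∏ j, g ((Iio j).image t) (t j) + ∏ j, g ((Ioi j).image t) (t j)) := by
    intro t ht
    have htI : ∀ j, t j ∈ Icc (1 : ℤ) N := fun j => Fintype.mem_piFinset.1 (hU ht) j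
    have hj : ∀ j, 1 ≤ 4 * N * (g ((Iio j).image t) (t j) * g ((Ioi j).image t) (t j)) := by
      intro j
      have ha := sharedModulus_ne_zero (f := f) (S := (Iio j).image t) (hQ0 _ (htI j))
      have hb := sharedModulus_ne_zero (f := f) (S := (Ioi j).image t) (hQ0 _ (htI j))
      obtain ⟨ρ, hρ, h1, h2⟩ := exists_mem_rootCentres hQ (htI j) (mul_ne_zero ha hb)
        (dvd_sharedModulus_mul_pow (f := f) hQ fun L h1 h2 => hdvd t ht j L fun l hl => by
          rcases lt_or_gt_of_ne hl with hl | hl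
          · exact h1 _ (mem_image_of_mem _ (mem_Iio.2 hl))
          · exact h2 _ (mem_image_of_mem _ (mem_Ioi.2 hl)))
      exact one_le_mul_centredWeight_mul_centredWeight hN ha hb hρ h1 (by exact_mod_cast h2)
    have hprod : 1 ≤ (4 * (N : ℝ)) ^ k * (4 * (N : ℝ)) ^ k *
        ((∏ j, g ((Iio j).image t) (t j)) * ∏ j, g ((Ioi j).image t) (t j)) := by
      rw [← pow_add, ← prod_mul_distrib]
      refine (prod_const_one.symm.trans_le
        (prod_le_prod (s := univ) (fun _ _ => zero_le_one) fun j _ => hj j)).trans_eq ?_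
      rw [prod_mul_distrib (f := fun _ : Fin (k + k) => 4 * (N : ℝ)), prod_const, card_univ,
        Fintype.card_fin]
    have hA := prod_nonneg (s := univ) fun j _ => hg0 ((Iio j).image t) (t j)
    have hB := prod_nonneg (s := univ) fun j _ => hg0 ((Ioi j).image t) (t j)
    have h4 : (0 : ℝ) ≤ (4 * N) ^ k := by positivity
    generalize (4 * (N : ℝ)) ^ k = v at *
    generalize ∏ j, g ((Iio j).image t) (t j) = y at *
    generalize ∏ j, g ((Ioi j).image t) (t j) = z at *
    by_contra! hlt
    have h5 : 0 ≤ v * (y + z) := by positivity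
    nlinarith [mul_nonneg (mul_nonneg h4 h4) (sq_nonneg (y - z)), sq_nonneg (v * (y - z))]
  calc (#U : ℝ) = ∑ t ∈ U, (1 : ℝ) := by simp
    _ ≤ ∑ t ∈ U, (4 * (N : ℝ)) ^ k *
          (∏ j, g ((Iio j).image t) (t j) + ∏ j, g ((Ioi j).image t) (t j)) := sum_le_sum hpoint
    _ ≤ ∑ t ∈ Fintype.piFinset fun _ : Fin (k + k) => Icc (1 : ℤ) N, (4 * (N : ℝ)) ^ k *
          (∏ j, g ((Iio j).image t) (t j) + ∏ j, g ((Ioi j).image t) (t j)) :=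
        sum_le_sum_of_subset_of_nonneg hU fun t _ _ => mul_nonneg (by positivity)
          (add_nonneg (prod_nonneg fun _ _ => hg0 _ _) (prod_nonneg fun _ _ => hg0 _ _))
    _ ≤ (4 * N) ^ k * (B ^ (k + k) + B ^ (k + k)) := by
        rw [← mul_sum, sum_add_distrib]
        gcongr
        · exact sum_piFinset_prod_Iio_le hB hg0 _ hsum
        · exact sum_piFinset_prod_Ioi_le hB hg0 _ _ le_rfl hsum
    _ = _ := by ring

theorem card_signed_reciprocal_solutions_le_of_card_divisors_le {k N p : ℕ} [Fact p.Prime]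
    {a : ZMod p} {e : Fin (k + k) → ℤ} (hk : 0 < k) (hkN : k + k ≤ N) (hp : N ^ (24 * k ^ 2) < p)
    (ha : ∀ x ∈ Icc (1 : ℤ) N, a + (x : ZMod p) ≠ 0) (he : ∀ i, |e i| = 1) {T : ℝ} (hT1 : 1 ≤ T)
    (hT : ∀ m : ℕ, m ≠ 0 → m ≤ N ^ (10 * k) → (#m.divisors : ℝ) ≤ T) :
    (#((Fintype.piFinset fun _ : Fin (k + k) => Icc (1 : ℤ) N).filter
      fun t => ∑ i, (e i : ZMod p) * (a + (t i : ZMod p))⁻¹ = 0) : ℝ) ≤ 2 * (4 * N) ^ k *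
      (T ^ (k + k) * (((k + k : ℕ) + 1) * (2 * (1 + Real.log N)))) ^ (k + k) := by
  set U := (Fintype.piFinset fun _ : Fin (k + k) => Icc (1 : ℤ) N).filter
      fun t => ∑ i, (e i : ZMod p) * (a + (t i : ZMod p))⁻¹ = 0 with hU
  have hUI : U ⊆ Fintype.piFinset fun _ => Icc (1 : ℤ) N := filter_subset _ _
  have htI : ∀ t ∈ U, ∀ j, t j ∈ Icc (1 : ℤ) N := fun t ht j => Fintype.mem_piFinset.1 (hUI ht) j
  have hN1 : N + 1 ≤ N ^ 2 := by nlinarith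
  have hM : (k + k) * (N + 1) ^ (k + k) ≤ N ^ (6 * k) := by
    calc (k + k) * (N + 1) ^ (k + k) ≤ N ^ (2 * k) * (N ^ 2) ^ (k + k) := by
          gcongr
          exact hkN.trans (Nat.le_self_pow (by omega) N)
      _ = N ^ (6 * k) := by
          rw [← pow_mul, ← pow_add]
          ring_nf
  have hM' : ((k + k : ℕ) * ((N : ℝ) + 1) ^ (k + k)) ≤ (N : ℝ) ^ (6 * k) := by exact_mod_cast hM
  have hN0 : (1 : ℝ) ≤ N := by exact_mod_cast (show 1 ≤ N by omega)
  obtain ⟨Q, hQ, hQ0, hQd, hQM, hQne, hQdvd⟩ := exists_primitive_common_divisor (p := p) (a := a)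
    (n := k + k) (N := N) (by omega) (one_le_pow₀ (n := 6 * k) hN0)
    (by rw [← pow_mul, show 6 * k * (2 * (k + k)) = 24 * k ^ 2 by ring]; exact_mod_cast hp) ha
    ((fun t => reciprocalNumerator e t) '' (U : Set (Fin (k + k) → ℤ)))
    (Set.forall_mem_image.2 fun t _ => by simpa using natDegree_reciprocalNumerator_le e t)
    (Set.forall_mem_image.2 fun t ht => eval_reciprocalNumerator_eq_zero
      (fun i => ha _ (htI t ht i)) (mem_filter.1 ht).2)
    (Set.forall_mem_image.2 fun t ht z => by
      have := norm_eval_reciprocalNumerator_le (N := N) he (t := t) (fun i => by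
        have := mem_Icc.1 (htI t ht i)
        rw [abs_le]
        omega) z
      rw [Fintype.card_fin] at this
      exact this.trans (by gcongr))
  refine card_le_of_eval_neg_dvd_pow hQ0 (by omega) hQd hQne hT1 (fun x hx => ?_) hUI
    fun t ht j L hL => hQ.eval_neg_dvd_pow hQ0 (hQdvd _ (Set.mem_image_of_mem _ ht))
      (Int.isUnit_iff_abs_eq.2 (he j)) hL
  refine hT _ (Int.natAbs_ne_zero.2 (hQne x hx)) ?_
  have hxN : |x| ≤ N := by
    have := mem_Icc.1 hx
    rw [abs_le]
    omega
  have h1 : ((|Q.eval (-x)| : ℤ) : ℝ) ≤ (N : ℝ) ^ (10 * k) := by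
    calc ((|Q.eval (-x)| : ℤ) : ℝ) ≤ ((N : ℝ) + 1) ^ Q.natDegree *
          (Q.map (Int.castRingHom ℂ)).mahlerMeasure := abs_eval_neg_le hxN
      _ ≤ ((N : ℝ) ^ 2) ^ (k + k) * (N : ℝ) ^ (6 * k) := by
          have h2 : (N : ℝ) + 1 ≤ (N : ℝ) ^ 2 := by exact_mod_cast hN1
          have h3 : ((N : ℝ) + 1) ^ Q.natDegree ≤ ((N : ℝ) + 1) ^ (k + k) :=
            pow_le_pow_right₀ (by linarith) hQd
          exact mul_le_mul (h3.trans (by gcongr)) hQM (mahlerMeasure_nonneg _) (by positivity)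
      _ = (N : ℝ) ^ (10 * k) := by
          rw [← pow_mul, ← pow_add]
          ring_nf
  rw [Int.abs_eq_natAbs] at h1
  exact_mod_cast h1

theorem exists_card_signed_reciprocal_solutions_le {k : ℕ} (hk : 0 < k) {ε : ℝ} (hε : 0 < ε) :
    ∃ C : ℝ, 0 < C ∧ ∀ {p : ℕ} [Fact p.Prime] {a : ZMod p} {N : ℕ} {e : Fin (k + k) → ℤ},
      N ≠ 0 → N ^ (24 * k ^ 2) < p → (∀ x ∈ Icc (1 : ℤ) N, a + (x : ZMod p) ≠ 0) →
      (∀ i, |e i| = 1) →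
      (#((Fintype.piFinset fun _ : Fin (k + k) => Icc (1 : ℤ) N).filter
        fun t => ∑ i, (e i : ZMod p) * (a + (t i : ZMod p))⁻¹ = 0) : ℝ) ≤
      C * (N : ℝ) ^ ((k : ℝ) + ε) := by
  set δ : ℝ := ε / ((20 * k ^ 2 + 1) * (k + k) : ℕ) with hδdef
  have hδ : 0 < δ := by positivity
  obtain ⟨D, hD1, hD⟩ := Nat.exists_card_divisors_le_rpow hδ
  set K : ℝ := D ^ (k + k) * (((k + k : ℕ) + 1) * (2 * (1 + 1 / δ))) with hK
  refine ⟨((k + k : ℕ) : ℝ) ^ (k + k) + 2 * 4 ^ k * K ^ (k + k), by positivity, ?_⟩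
  intro p _ a N e hN hp ha he
  have hN1 : (1 : ℝ) ≤ N := by exact_mod_cast Nat.one_le_iff_ne_zero.2 hN
  have hpow1 : 1 ≤ (N : ℝ) ^ ((k : ℝ) + ε) := Real.one_le_rpow hN1 (by positivity)
  rcases lt_or_ge N (k + k) with hlt | hkN
  · have h1 : (#((Fintype.piFinset fun _ : Fin (k + k) => Icc (1 : ℤ) N).filter
        fun t => ∑ i, (e i : ZMod p) * (a + (t i : ZMod p))⁻¹ = 0) : ℝ) ≤
        ((k + k : ℕ) : ℝ) ^ (k + k) := by
      norm_cast
      refine (card_filter_le _ _).trans ?_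
      simp only [Fintype.card_piFinset, Int.card_Icc, prod_const, card_univ, Fintype.card_fin]
      exact Nat.pow_le_pow_left (by omega) _
    have hK0 : 0 ≤ 2 * 4 ^ k * K ^ (k + k) := by positivity
    have h2 : (0 : ℝ) ≤ ((k + k : ℕ) : ℝ) ^ (k + k) := by positivity
    nlinarith
  · set η : ℝ := (N : ℝ) ^ δ with hη
    have hη1 : 1 ≤ η := Real.one_le_rpow hN1 hδ.le
    have hT1 : 1 ≤ D * η ^ (10 * k) := one_le_mul_of_one_le_of_one_le hD1 (one_le_pow₀ hη1)
    have hηpow : η ^ ((20 * k ^ 2 + 1) * (k + k)) = (N : ℝ) ^ ε := by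
      rw [hη, ← Real.rpow_natCast, ← Real.rpow_mul (by positivity), hδdef,
        div_mul_cancel₀ _ (by positivity)]
    refine (card_signed_reciprocal_solutions_le_of_card_divisors_le hk hkN hp ha he hT1
      fun m hm hmN => (hD m hm).trans ?_).trans ?_
    · rw [hη, ← Real.rpow_natCast, ← Real.rpow_mul (by positivity), mul_comm δ,
        Real.rpow_mul (by positivity), Real.rpow_natCast]
      gcongr
      exact_mod_cast hmN
    · calc 2 * (4 * (N : ℝ)) ^ k * ((D * η ^ (10 * k)) ^ (k + k) *
            (((k + k : ℕ) + 1) * (2 * (1 + Real.log N)))) ^ (k + k)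
          ≤ 2 * (4 * (N : ℝ)) ^ k * ((D * η ^ (10 * k)) ^ (k + k) *
            (((k + k : ℕ) + 1) * (2 * ((1 + 1 / δ) * η)))) ^ (k + k) := by
            have := Real.log_natCast_nonneg N
            gcongr
            exact Real.one_add_log_le_rpow hδ hN1
        _ = 2 * (4 * (N : ℝ)) ^ k * (K * η ^ (20 * k ^ 2 + 1)) ^ (k + k) := by
            rw [hK, mul_pow D, ← pow_mul η, pow_succ η]
            ring_nf
        _ = 2 * 4 ^ k * K ^ (k + k) * (N : ℝ) ^ ((k : ℝ) + ε) := by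
            rw [mul_pow K, ← pow_mul η, hηpow, Real.rpow_add (by positivity), Real.rpow_natCast,
              mul_pow 4]
            ring
        _ ≤ _ := by
            gcongr
            simp

theorem lt_of_zero_notMem_interval {p : ℕ} [NeZero p] {a : ZMod p} {N : ℕ}
    (h : (0 : ZMod p) ∉ interval p a N) : N < p := by
  by_contra! hN
  refine h (mem_image.2 ⟨p - a.val, mem_Icc.2 ⟨?_, ?_⟩, ?_⟩)
  · have := a.val_lt
    omega
  · omega
  · rw [Nat.cast_sub a.val_lt.le]
    simp

theorem card_interval {p : ℕ} {a : ZMod p} {N : ℕ} (hN : N < p) : #(interval p a N) = N := by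
  rw [interval, card_image_of_injOn, Nat.card_Icc, Nat.add_sub_cancel]
  intro i hi j hj hij
  have hi' := (mem_Icc.1 hi).2
  have hj' := (mem_Icc.1 hj).2
  have h := add_left_cancel hij
  rw [ZMod.natCast_eq_natCast_iff] at h
  exact Nat.ModEq.eq_of_lt_of_lt h (by omega) (by omega)

theorem card_filter_sum_inv_eq_le {p : ℕ} (k : ℕ) (a : ZMod p) (N : ℕ) :
    #(((Fintype.piFinset fun _ : Fin k => interval p a N) ×ˢ
        Fintype.piFinset fun _ : Fin k => interval p a N).filter
        (fun xy => (∑ i, (xy.1 i)⁻¹) = ∑ i, (xy.2 i)⁻¹)) ≤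
      #((Fintype.piFinset fun _ : Fin (k + k) => Icc (1 : ℤ) N).filter fun t =>
        ∑ i, ((Fin.append 1 (-1) : Fin (k + k) → ℤ) i : ZMod p) * (a + (t i : ZMod p))⁻¹ = 0) := by
  refine (card_le_card fun xy hxy => ?_).trans (card_image_le (f := fun t =>
    (fun i => a + (t (Fin.castAdd k i) : ZMod p), fun i => a + (t (Fin.natAdd k i) : ZMod p))))
  obtain ⟨hmem, hsum⟩ := mem_filter.1 hxy
  obtain ⟨hx, hy⟩ := mem_product.1 hmem
  have hlift : ∀ z ∈ interval p a N, ∃ u ∈ Icc (1 : ℤ) N, a + (u : ZMod p) = z := by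
    intro z hz
    obtain ⟨i, hi, rfl⟩ := mem_image.1 hz
    have := mem_Icc.1 hi
    exact ⟨i, mem_Icc.2 (by omega), by simp⟩
  choose u hu hux using fun i => hlift _ (Fintype.mem_piFinset.1 hx i)
  choose v hv hvy using fun i => hlift _ (Fintype.mem_piFinset.1 hy i)
  refine mem_image.2 ⟨Fin.append u v, mem_filter.2 ⟨Fintype.mem_piFinset.2 ?_, ?_⟩, ?_⟩
  · exact Fin.addCases (by simpa using hu) (by simpa [-Fin.natAdd_eq_addNat] using hv)
  · simp [-Fin.natAdd_eq_addNat, Fin.sum_univ_add, hux, hvy, hsum]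
  · simp [-Fin.natAdd_eq_addNat, hux, hvy]

/-- there is an absolute constant `c > 0` such that for every `k ≥ 1` and every
`ε > 0` there is `C > 0` such that for every prime `p` and every interval `I ⊂ F_p` not
containing `0` with `|I| < p^{c/k²}`, the number `J_{2k}` of tuples `(x_1,…,x_{2k}) ∈ I^{2k}`
with `x_1⁻¹+…+x_k⁻¹ = x_{k+1}⁻¹+…+x_{2k}⁻¹` satisfies `J_{2k} ≤ C·|I|^{k+ε}`. -/
theorem stmt_4 :
    ∃ c : ℝ, 0 < c ∧
      ∀ (k : ℕ), 0 < k → ∀ ε : ℝ, 0 < ε →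
        ∃ C : ℝ, 0 < C ∧
          ∀ (p : ℕ), p.Prime → ∀ (a : ZMod p) (N : ℕ),
            (0 : ZMod p) ∉ interval p a N →
            ((interval p a N).card : ℝ) < (p : ℝ) ^ (c / (k : ℝ) ^ 2) →
            ((((Fintype.piFinset fun _ : Fin k => interval p a N) ×ˢ
                  Fintype.piFinset fun _ : Fin k => interval p a N).filter
                (fun xy => (∑ i, (xy.1 i)⁻¹) = ∑ i, (xy.2 i)⁻¹)).card : ℝ) ≤
              C * ((interval p a N).card : ℝ) ^ ((k : ℝ) + ε) := by
  refine ⟨1 / 24, by norm_num, fun k hk ε hε => ?_⟩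
  obtain ⟨C, hC, hbound⟩ := exists_card_signed_reciprocal_solutions_le hk hε
  refine ⟨C, hC, fun p hp a N h0 hlt => ?_⟩
  have : Fact p.Prime := ⟨hp⟩
  rw [card_interval (lt_of_zero_notMem_interval h0)] at hlt ⊢
  refine le_trans (Nat.cast_le.2 (card_filter_sum_inv_eq_le k a N)) ?_
  rcases eq_or_ne N 0 with rfl | hN
  · refine (Nat.cast_le.2 (card_filter_le _ _)).trans ?_
    rw [Fintype.card_piFinset_const, Nat.cast_zero, Int.card_Icc]
    simp only [zero_add, sub_self, Int.toNat_zero, zero_pow (show k + k ≠ 0 by omega)]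
    exact Nat.cast_zero.trans_le (by positivity)
  refine hbound hN ?_ (fun x hx hx0 => ?_) ?_
  · have h1 := pow_lt_pow_left₀ hlt (Nat.cast_nonneg N) (n := 24 * k ^ 2) (by positivity)
    rw [← Real.rpow_natCast ((p : ℝ) ^ _), ← Real.rpow_mul (Nat.cast_nonneg p)] at h1
    have h2 : 1 / 24 / (k : ℝ) ^ 2 * ((24 * k ^ 2 : ℕ) : ℝ) = 1 := by
      have : (k : ℝ) ≠ 0 := by positivity
      push_cast
      field_simp
    rw [h2, Real.rpow_one] at h1
    exact_mod_cast h1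
  · have := mem_Icc.1 hx
    refine h0 (mem_image.2 ⟨x.toNat, mem_Icc.2 (by omega), ?_⟩)
    rw [← hx0, ← Int.cast_natCast, Int.toNat_of_nonneg (by omega)]
  · exact Fin.addCases (by simp) (by simp [-Fin.natAdd_eq_addNat])
end

section
/- Let p be a prime, k a positive integer, and N an integer with N ≥ 2. Then the number J_{2k} of tuples (x_1,…,x_{2k}) of integers with 1 ≤ x_i ≤ N, each x_i coprime to p, satisfying the congruence x_1* + … + x_k* ≡ x_{k+1}* + … + x_{2k}* (mod p), satisfies J_{2k} ≤ (2k)^{90k³}·(log N)^{4k²}·(N^{2k−1}/p + 1)·N^{k}. -/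
open Finset

section Squareful

variable {ι : Type*} [Fintype ι] [DecidableEq ι]

/-- The tuple whose entries are the products of the parameters `a` (each contributing to two
coordinates) and `b` (each contributing to three coordinates). -/
def pairTripleProd (a : ι × ι → ℕ) (b : ι × ι × ι → ℕ) : ι → ℕ :=
  (∏ s, (Pi.mulSingle s.1 (a s) * Pi.mulSingle s.2 (a s) : ι → ℕ)) *
    ∏ t, (Pi.mulSingle t.1 (b t) * Pi.mulSingle t.2.1 (b t) * Pi.mulSingle t.2.2 (b t) : ι → ℕ)

theorem pairTripleProd_mul (a a' : ι × ι → ℕ) (b b' : ι × ι × ι → ℕ) :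
    pairTripleProd (a * a') (b * b') = pairTripleProd a b * pairTripleProd a' b' := by
  simp only [pairTripleProd, Pi.mul_apply, Pi.mulSingle_mul, Finset.prod_mul_distrib]
  ac_rfl

theorem pairTripleProd_mulSingle_left (s : ι × ι) (q : ℕ) :
    pairTripleProd (Pi.mulSingle s q) 1 = Pi.mulSingle s.1 q * Pi.mulSingle s.2 q := by
  unfold pairTripleProd
  rw [Finset.prod_eq_single s] <;> simp +contextual

theorem pairTripleProd_mulSingle_right (t : ι × ι × ι) (q : ℕ) :
    pairTripleProd 1 (Pi.mulSingle t q) =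
      Pi.mulSingle t.1 q * Pi.mulSingle t.2.1 q * Pi.mulSingle t.2.2 q := by
  unfold pairTripleProd
  rw [Finset.prod_eq_single t (s := univ (α := ι × ι × ι))] <;>
    simp +contextual

theorem prod_pairTripleProd (a : ι × ι → ℕ) (b : ι × ι × ι → ℕ) :
    ∏ i, pairTripleProd a b i = (∏ s, a s ^ 2) * ∏ t, b t ^ 3 := by
  simp only [pairTripleProd, Pi.mul_apply, Finset.prod_apply, Finset.prod_mul_distrib]
  congr 1
  · rw [Finset.prod_comm, Finset.prod_comm (f := fun i s => (Pi.mulSingle (Prod.snd s) (a s) : ι → ℕ) i)]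
    simp [Finset.prod_pi_mulSingle', ← Finset.prod_mul_distrib, sq]
  · rw [Finset.prod_comm,
      Finset.prod_comm (f := fun i s => (Pi.mulSingle (Prod.fst (Prod.snd s)) (b s) : ι → ℕ) i),
      Finset.prod_comm (f := fun i s => (Pi.mulSingle (Prod.snd (Prod.snd s)) (b s) : ι → ℕ) i)]
    simp [Finset.prod_pi_mulSingle', ← Finset.prod_mul_distrib, pow_succ]

theorem dvd_pairTripleProd_left (a : ι × ι → ℕ) (b : ι × ι × ι → ℕ) (s : ι × ι) :
    a s ∣ pairTripleProd a b s.1 := by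
  simp only [pairTripleProd, Pi.mul_apply, Finset.prod_apply]
  refine Dvd.dvd.mul_right ?_ _
  refine dvd_trans ?_ (Finset.dvd_prod_of_mem _ (Finset.mem_univ s))
  simp

theorem dvd_pairTripleProd_right (a : ι × ι → ℕ) (b : ι × ι × ι → ℕ) (t : ι × ι × ι) :
    b t ∣ pairTripleProd a b t.1 := by
  simp only [pairTripleProd, Pi.mul_apply, Finset.prod_apply]
  refine Dvd.dvd.mul_left ?_ _
  refine dvd_trans ?_ (Finset.dvd_prod_of_mem _ (Finset.mem_univ t))
  simp [mul_assoc]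

theorem exists_eq_mulSingle_mul {q : ℕ} (hq : q.Prime) {x : ι → ℕ} (h : q ∣ ∏ i, x i) :
    ∃ (i : ι) (x' : ι → ℕ), x = Pi.mulSingle i q * x' ∧ ∏ i, x i = q * ∏ i, x' i := by
  obtain ⟨i, -, y, hy⟩ := (hq.prime.dvd_finsetProd_iff x).1 h
  have hx : x = Pi.mulSingle i q * Function.update x i y := by
    ext j
    by_cases hj : j = i
    · subst hj; simp [hy]
    · simp [hj]
  refine ⟨i, _, hx, ?_⟩
  conv_lhs => rw [hx]
  simp [Finset.prod_mul_distrib, Finset.prod_pi_mulSingle']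

/-- A tuple of positive integers whose product is powerful is a `pairTripleProd`. -/
theorem exists_eq_pairTripleProd (x : ι → ℕ) (hpos : ∏ i, x i ≠ 0)
    (hx : ∀ q : ℕ, q.Prime → q ∣ ∏ i, x i → q ^ 2 ∣ ∏ i, x i) :
    ∃ a b, x = pairTripleProd a b := by
  induction hn : ∏ i, x i using Nat.strong_induction_on generalizing x with
  | _ n ih =>
  subst hn
  by_cases h1 : ∏ i, x i = 1
  · refine ⟨1, 1, ?_⟩
    ext i
    have : x i = 1 := (Finset.prod_eq_one_iff.1 h1) i (mem_univ i)
    simp [this, pairTripleProd]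
  obtain ⟨q, hq, hqx⟩ := Nat.exists_prime_and_dvd h1
  have hq2 := hx q hq hqx
  obtain ⟨i, x₁, hx₁, hp₁⟩ := exists_eq_mulSingle_mul hq hqx
  rw [hp₁, sq, Nat.mul_dvd_mul_iff_left hq.pos] at hq2
  obtain ⟨j, x₂, hx₂, hp₂⟩ := exists_eq_mulSingle_mul hq hq2
  have hne2 : ∏ i, x₂ i ≠ 0 := by
    intro h; rw [hp₁, hp₂, h] at hpos; simp at hpos
  have other : ∀ r : ℕ, r.Prime → r ≠ q → ∀ m e, r ^ m ∣ q ^ e * ∏ i, x₂ i → r ^ m ∣ ∏ i, x₂ i := by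
    intro r hr hrq m e h
    exact (((Nat.coprime_primes hr hq).2 hrq).pow m e).dvd_of_dvd_mul_left h
  have hprod : ∏ i, x i = q ^ 2 * ∏ i, x₂ i := by rw [hp₁, hp₂]; ring
  by_cases h3 : q ∣ ∏ i, x₂ i → q ^ 2 ∣ ∏ i, x₂ i
  · obtain ⟨a, b, hab⟩ := ih (∏ i, x₂ i) (by
      rw [hprod]
      exact (Nat.lt_mul_iff_one_lt_left (Nat.pos_of_ne_zero hne2)).2
        (Nat.one_lt_pow two_ne_zero hq.one_lt)) x₂ hne2 (by
        intro r hr hrx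
        by_cases hrq : r = q
        · subst hrq; exact h3 hrx
        · refine other r hr hrq 2 2 ?_
          rw [← hprod]; refine hx r hr ?_
          rw [hprod]; exact hrx.mul_left _) rfl
    refine ⟨Pi.mulSingle (i, j) q * a, 1 * b, ?_⟩
    rw [pairTripleProd_mul, pairTripleProd_mulSingle_left, hx₁, hx₂, hab, mul_assoc]
  · push Not at h3
    obtain ⟨hd, hnd⟩ := h3
    obtain ⟨l, x₃, hx₃, hp₃⟩ := exists_eq_mulSingle_mul hq hd
    have hne3 : ∏ i, x₃ i ≠ 0 := by
      intro h; rw [hp₃, h] at hne2; simp at hne2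
    obtain ⟨a, b, hab⟩ := ih (∏ i, x₃ i) (by
      rw [hprod, hp₃, ← mul_assoc, ← pow_succ]
      exact (Nat.lt_mul_iff_one_lt_left (Nat.pos_of_ne_zero hne3)).2
        (Nat.one_lt_pow three_ne_zero hq.one_lt)) x₃ hne3 (by
        intro r hr hrx
        by_cases hrq : r = q
        · subst hrq
          exact absurd (by rw [hp₃, sq]; exact Nat.mul_dvd_mul_left _ hrx) hnd
        · have h := other r hr hrq 2 2 (by
            rw [← hprod]; refine hx r hr ?_
            rw [hprod, hp₃]; exact (hrx.mul_left _).mul_left _)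
          rw [hp₃] at h
          have hc := ((Nat.coprime_primes hr hq).2 hrq).pow 2 1
          rw [pow_one] at hc
          exact hc.dvd_of_dvd_mul_left h) rfl
    refine ⟨1 * a, Pi.mulSingle (i, j, l) q * b, ?_⟩
    rw [pairTripleProd_mul, pairTripleProd_mulSingle_right, hx₁, hx₂, hx₃, hab]
    simp only [mul_assoc]

end Squareful

theorem sum_inv_mul_sqrt_le (n : ℕ) :
    ∑ b ∈ Icc 1 n, ((b : ℝ) * √b)⁻¹ ≤ 3 := by
  have key : ∀ m : ℕ, ∑ b ∈ Icc 1 (m + 1), ((b : ℝ) * √b)⁻¹ ≤ 3 - 2 / √((m + 1 : ℕ) : ℝ) := by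
    intro m
    induction m with
    | zero => norm_num
    | succ m ih =>
      rw [Finset.sum_Icc_succ_top (by omega)]
      have h1 : (0 : ℝ) < ((m + 1 : ℕ) : ℝ) := by positivity
      have h2 : ((m + 1 + 1 : ℕ) : ℝ) = ((m + 1 : ℕ) : ℝ) + 1 := by push_cast; ring
      set s := √((m + 1 : ℕ) : ℝ) with hs
      set t := √((m + 1 + 1 : ℕ) : ℝ) with ht
      have hs0 : 0 < s := Real.sqrt_pos.2 h1
      have ht0 : 0 < t := Real.sqrt_pos.2 (by rw [h2]; positivity)
      have hs2 : s * s = ((m + 1 : ℕ) : ℝ) := Real.mul_self_sqrt h1.le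
      have ht2 : t * t = ((m + 1 + 1 : ℕ) : ℝ) := Real.mul_self_sqrt (by positivity)
      have hst : t * t = s * s + 1 := by rw [hs2, ht2, h2]
      have hle : s ≤ t := by nlinarith
      have : (((m + 1 + 1 : ℕ) : ℝ) * t)⁻¹ ≤ 2 / s - 2 / t := by
        rw [← ht2, div_sub_div _ _ hs0.ne' ht0.ne', inv_eq_one_div,
          div_le_div_iff₀ (by positivity) (by positivity)]
        have h3 : 1 = (t - s) * (t + s) := by linarith
        have h4 : s ≤ 2 * t * t * (t - s) := by nlinarith [mul_pos hs0 ht0]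
        nlinarith
      linarith
  cases n with
  | zero => simp
  | succ m =>
    refine (key m).trans ?_
    have : (0 : ℝ) ≤ 2 / √((m + 1 : ℕ) : ℝ) := by positivity
    linarith

theorem sum_inv_le_one_add_log (n : ℕ) : ∑ b ∈ Icc 1 n, (b : ℝ)⁻¹ ≤ 1 + Real.log n := by
  have := harmonic_le_one_add_log n
  rw [harmonic_eq_sum_Icc] at this
  push_cast at this
  exact this

theorem card_le_of_gaps {α : Type*} (s : Finset α) (f : α → ℝ) {δ L : ℝ} (hδ : 0 < δ)
    (hL : 0 ≤ L) (h0 : ∀ a ∈ s, 0 ≤ f a) (h1 : ∀ a ∈ s, f a ≤ L)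
    (hgap : ∀ a ∈ s, ∀ b ∈ s, a ≠ b → δ ≤ |f a - f b|) : (#s : ℝ) ≤ L / δ + 1 := by
  have hcard : #s ≤ #(range (⌊L / δ⌋₊ + 1)) := by
    refine Finset.card_le_card_of_injOn (fun a => ⌊f a / δ⌋₊) ?_ ?_
    · intro a ha
      simp only [coe_range, Set.mem_Iio, Nat.lt_succ_iff]
      exact Nat.floor_le_floor (by gcongr; exact h1 a ha)
    · intro a ha b hb hab
      by_contra hne
      have hg := hgap a ha b hb hne
      have ha' := Nat.floor_le (div_nonneg (h0 a ha) hδ.le)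
      have hb' := Nat.floor_le (div_nonneg (h0 b hb) hδ.le)
      have ha'' := Nat.lt_floor_add_one (f a / δ)
      have hb'' := Nat.lt_floor_add_one (f b / δ)
      have hab' : (⌊f a / δ⌋₊ : ℝ) = ⌊f b / δ⌋₊ := by exact_mod_cast hab
      have : |f a / δ - f b / δ| < 1 := by rw [abs_lt]; constructor <;> linarith
      rw [← sub_div, abs_div, abs_of_pos hδ, div_lt_one hδ] at this
      linarith
  rw [card_range] at hcard
  calc (#s : ℝ) ≤ ((⌊L / δ⌋₊ + 1 : ℕ) : ℝ) := by exact_mod_cast hcard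
    _ ≤ L / δ + 1 := by push_cast; gcongr; exact Nat.floor_le (by positivity)

theorem card_fractions_le_of_le {α : Type*} (s : Finset α) (u v : α → ℕ) {p : ℕ} (hp : 0 < p)
    {B L : ℝ} (hB : 0 < B) (hL : 0 ≤ L) (hv : ∀ a ∈ s, 0 < v a) (hvB : ∀ a ∈ s, (v a : ℝ) ≤ B)
    (hr : ∀ a ∈ s, (u a : ℝ) / v a ≤ L)
    (hne : ∀ a ∈ s, ∀ b ∈ s, a ≠ b → u a * v b ≠ u b * v a)
    (hmod : ∀ a ∈ s, ∀ b ∈ s, u a * v b ≡ u b * v a [MOD p]) :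
    (#s : ℝ) ≤ L * B ^ 2 / p + 1 := by
  have hp' : (0 : ℝ) < p := by exact_mod_cast hp
  have h := card_le_of_gaps s (fun a => (u a : ℝ) / v a) (δ := p / B ^ 2) (L := L)
    (by positivity) hL (fun a _ => by positivity) hr (by
      intro a ha b hb hab
      have hva : (0 : ℝ) < v a := by exact_mod_cast hv a ha
      have hvb : (0 : ℝ) < v b := by exact_mod_cast hv b hb
      rw [div_sub_div _ _ hva.ne' hvb.ne', abs_div, abs_of_pos (mul_pos hva hvb)]
      have hnum : (p : ℝ) ≤ |(u a : ℝ) * v b - v a * u b| := by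
        have hd := (Nat.modEq_iff_dvd.1 (hmod b hb a ha))
        have hz : ((u a * v b : ℕ) : ℤ) - ((u b * v a : ℕ) : ℤ) ≠ 0 := by
          rw [sub_ne_zero]; exact_mod_cast hne a ha b hb hab
        have := Int.le_of_dvd (abs_pos.2 hz) ((dvd_abs _ _).2 hd)
        have h2 : ((p : ℤ) : ℝ) ≤ ((|((u a * v b : ℕ) : ℤ) - ((u b * v a : ℕ) : ℤ)| : ℤ) : ℝ) := by
          exact_mod_cast this
        push_cast at h2
        rwa [mul_comm (u b : ℝ)] at h2
      have hden : (v a : ℝ) * v b ≤ B ^ 2 := by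
        rw [sq]; exact mul_le_mul (hvB a ha) (hvB b hb) hvb.le hB.le
      exact div_le_div₀ (abs_nonneg _) hnum (mul_pos hva hvb) hden)
  rwa [div_div_eq_mul_div] at h

/-- Distinct fractions `u / v` with `u ≤ A`, `v ≤ B` that are all congruent modulo `p` are few. -/
theorem card_fractions_le {α : Type*} (s : Finset α) (u v : α → ℕ) {p : ℕ} (hp : 0 < p)
    {A B : ℝ} (hA : 0 < A) (hB : 0 < B) (hu : ∀ a ∈ s, 0 < u a) (hv : ∀ a ∈ s, 0 < v a)
    (huA : ∀ a ∈ s, (u a : ℝ) ≤ A) (hvB : ∀ a ∈ s, (v a : ℝ) ≤ B)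
    (hne : ∀ a ∈ s, ∀ b ∈ s, a ≠ b → u a * v b ≠ u b * v a)
    (hmod : ∀ a ∈ s, ∀ b ∈ s, u a * v b ≡ u b * v a [MOD p]) :
    (#s : ℝ) ≤ 2 * (A * B / p + 1) := by
  classical
  have h1 := card_fractions_le_of_le (s.filter fun a => (u a : ℝ) / v a ≤ A / B) u v hp
    (B := B) (L := A / B) hB (by positivity) (fun a ha => hv a (mem_filter.1 ha).1)
    (fun a ha => hvB a (mem_filter.1 ha).1) (fun a ha => (mem_filter.1 ha).2)
    (fun a ha b hb => hne a (mem_filter.1 ha).1 b (mem_filter.1 hb).1)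
    (fun a ha b hb => hmod a (mem_filter.1 ha).1 b (mem_filter.1 hb).1)
  have h2 := card_fractions_le_of_le (s.filter fun a => ¬ (u a : ℝ) / v a ≤ A / B) v u hp
    (B := A) (L := B / A) hA (by positivity) (fun a ha => hu a (mem_filter.1 ha).1)
    (fun a ha => huA a (mem_filter.1 ha).1)
    (fun a ha => by
      obtain ⟨has, hlt⟩ := mem_filter.1 ha
      have hva : (0 : ℝ) < v a := by exact_mod_cast hv a has
      have hua : (0 : ℝ) < u a := by exact_mod_cast hu a has
      rw [not_le, div_lt_div_iff₀ hB hva] at hlt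
      rw [div_le_div_iff₀ hua hA]
      linarith)
    (fun a ha b hb hab h => hne a (mem_filter.1 ha).1 b (mem_filter.1 hb).1 hab (by linarith))
    (fun a ha b hb => by
      have := hmod b (mem_filter.1 hb).1 a (mem_filter.1 ha).1
      rwa [mul_comm (u b), mul_comm (u a)] at this)
  have h3 := card_filter_add_card_filter_not (s := s) (fun a => (u a : ℝ) / v a ≤ A / B)
  have h4 : (#s : ℝ) = #(s.filter fun a => (u a : ℝ) / v a ≤ A / B) +
      #(s.filter fun a => ¬ (u a : ℝ) / v a ≤ A / B) := by exact_mod_cast h3.symm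
  have e1 : A / B * B ^ 2 / p = A * B / p := by field_simp
  have e2 : B / A * A ^ 2 / p = A * B / p := by field_simp
  rw [e1] at h1
  rw [e2] at h2
  linarith

section Collisions

variable {α β γ : Type*} [DecidableEq β] [DecidableEq γ]

theorem card_filter_eq_sum_sq (T : Finset α) (f : α → β) :
    #((T ×ˢ T).filter fun ab => f ab.1 = f ab.2) =
      ∑ z ∈ T.image f, #(T.filter fun a => f a = z) ^ 2 := by
  rw [card_eq_sum_card_fiberwise (f := fun ab : α × α => f ab.1) (t := T.image f)]
  · refine sum_congr rfl fun z _ => ?_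
    rw [sq, ← card_product]
    congr 1
    ext ⟨a, b⟩
    simp only [mem_filter, mem_product]
    grind
  · intro ab hab
    simp only [coe_filter, mem_product, Set.mem_ofPred_eq] at hab
    simpa using ⟨ab.1, hab.1.1, rfl⟩

theorem card_sq_le_mul_card_filter_eq (T : Finset α) (r : α → β) {M : ℝ}
    (hM : (#(T.image r) : ℝ) ≤ M) :
    (#T : ℝ) ^ 2 ≤ M * #((T ×ˢ T).filter fun ab => r ab.1 = r ab.2) := by
  rw [card_filter_eq_sum_sq, card_eq_sum_card_image r T]
  push_cast
  refine (sq_sum_le_card_mul_sum_sq).trans ?_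
  gcongr

/-- If the fibres of `c` meet at most `M` fibres of `r`, then `c` has at most `M` times as many
collisions as `r`. -/
theorem card_collisions_le (T : Finset α) (c : α → γ) (r : α → β) {M : ℝ}
    (hM : ∀ S ⊆ T, Set.InjOn r S → (∀ a ∈ S, ∀ b ∈ S, c a = c b) → (#S : ℝ) ≤ M) :
    (#((T ×ˢ T).filter fun ab => c ab.1 = c ab.2) : ℝ) ≤
      M * #((T ×ˢ T).filter fun ab => r ab.1 = r ab.2) := by
  classical
  have hM0 : 0 ≤ M := by simpa using hM ∅ (empty_subset _) (by simp) (by simp)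
  rw [card_filter_eq_sum_sq]
  push_cast
  have hfib : ∀ z ∈ T.image c, (#(T.filter fun a => c a = z) : ℝ) ^ 2 ≤
      M * #(((T.filter fun a => c a = z) ×ˢ (T.filter fun a => c a = z)).filter
        fun ab => r ab.1 = r ab.2) := by
    intro z _
    refine card_sq_le_mul_card_filter_eq _ r ?_
    obtain ⟨S, hS, hinj, himg⟩ := Set.SurjOn.exists_subset_injOn_image_eq
      (f := r) (s := (T.filter fun a => c a = z : Finset α)) (Set.surjOn_image r _)
    lift S to Finset α using (Finset.finite_toSet _).subset hS
    have himg' : S.image r = (T.filter fun a => c a = z).image r := by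
      rw [← coe_inj, coe_image, coe_image, himg]
    rw [coe_subset] at hS
    rw [← himg', card_image_of_injOn hinj]
    refine hM S (hS.trans (filter_subset _ _)) hinj fun a ha b hb => ?_
    rw [(mem_filter.1 (hS ha)).2, (mem_filter.1 (hS hb)).2]
  refine (sum_le_sum hfib).trans ?_
  rw [← mul_sum]
  gcongr
  have hsub : ∑ z ∈ T.image c, #(((T.filter fun a => c a = z) ×ˢ (T.filter fun a => c a = z)).filter
        fun ab => r ab.1 = r ab.2) ≤ #((T ×ˢ T).filter fun ab => r ab.1 = r ab.2) := by
    rw [← card_biUnion]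
    · refine card_le_card fun ab h => ?_
      simp only [mem_biUnion, mem_filter, mem_product] at h ⊢
      grind
    · intro z _ w _ hzw
      rw [Function.onFun, disjoint_left]
      intro ab h h'
      simp only [mem_filter, mem_product] at h h'
      grind
  exact_mod_cast hsub

end Collisions

/-- There are few tuples in `[1, N]` whose product is powerful. -/
theorem card_powerful_tuples_le {ι : Type*} [Fintype ι] [DecidableEq ι] (N : ℕ)
    (S : Finset (ι → ℕ)) (hS : S ⊆ Fintype.piFinset fun _ => Icc 1 N)
    (hpow : ∀ x ∈ S, ∀ q : ℕ, q.Prime → q ∣ ∏ i, x i → q ^ 2 ∣ ∏ i, x i) :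
    (#S : ℝ) ≤ √((N : ℝ) ^ Fintype.card ι) *
      ((1 + Real.log N) ^ Fintype.card ι ^ 2 * 3 ^ Fintype.card ι ^ 3) := by
  have hmem : ∀ x ∈ S, ∀ i, 1 ≤ x i ∧ x i ≤ N := fun x hx i =>
    mem_Icc.1 (Fintype.mem_piFinset.1 (hS hx) i)
  set w : (ι → ℕ) → ℝ := fun x => (√((∏ i, x i : ℕ) : ℝ))⁻¹ with hw
  set P : Finset ((ι × ι → ℕ) × (ι × ι × ι → ℕ)) :=
    (Fintype.piFinset fun _ => Icc 1 N) ×ˢ (Fintype.piFinset fun _ => Icc 1 N) with hP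
  have hwle : ∀ x ∈ S, 1 ≤ √((N : ℝ) ^ Fintype.card ι) * w x := by
    intro x hx
    have hpos : 0 < ∏ i, x i := Finset.prod_pos fun i _ => (hmem x hx i).1
    have hle : ∏ i, x i ≤ N ^ Fintype.card ι := by
      simpa using Finset.prod_le_pow_card univ x N fun i _ => (hmem x hx i).2
    rw [hw, ← div_eq_mul_inv, one_le_div (Real.sqrt_pos.2 (by exact_mod_cast hpos))]
    exact Real.sqrt_le_sqrt (by exact_mod_cast hle)
  have himage : S ⊆ P.image fun ab => pairTripleProd ab.1 ab.2 := by
    intro x hx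
    have hpos : ∏ i, x i ≠ 0 :=
      (Finset.prod_pos fun i _ => (hmem x hx i).1).ne'
    obtain ⟨a, b, rfl⟩ := exists_eq_pairTripleProd x hpos (hpow x hx)
    refine mem_image.2 ⟨(a, b), ?_, rfl⟩
    simp only [hP, mem_product, Fintype.mem_piFinset, mem_Icc]
    have hdvd : ∀ d i, d ∣ pairTripleProd a b i → 1 ≤ d ∧ d ≤ N := fun d i hd =>
      ⟨Nat.pos_of_dvd_of_pos hd (hmem _ hx i).1,
        (Nat.le_of_dvd (hmem _ hx i).1 hd).trans (hmem _ hx i).2⟩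
    exact ⟨fun s => hdvd _ _ (dvd_pairTripleProd_left a b s),
      fun t => hdvd _ _ (dvd_pairTripleProd_right a b t)⟩
  have hwprod : ∀ a : ι × ι → ℕ, ∀ b : ι × ι × ι → ℕ, w (pairTripleProd a b) =
      (∏ s, (a s : ℝ)⁻¹) * ∏ t, ((b t : ℝ) * √(b t))⁻¹ := by
    intro a b
    rw [hw]
    dsimp only
    rw [prod_pairTripleProd, Finset.prod_inv_distrib, Finset.prod_inv_distrib, ← mul_inv]
    congr 1
    rw [Real.sqrt_eq_iff_mul_self_eq (by positivity) (by positivity)]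
    push_cast
    rw [mul_mul_mul_comm, ← Finset.prod_mul_distrib, ← Finset.prod_mul_distrib]
    congr 1
    · exact Finset.prod_congr rfl fun s _ => sq _
    · refine Finset.prod_congr rfl fun t _ => ?_
      rw [mul_mul_mul_comm, Real.mul_self_sqrt (by positivity)]
      ring
  have hsum : ∑ x ∈ S, w x ≤ (1 + Real.log N) ^ Fintype.card ι ^ 2 * 3 ^ Fintype.card ι ^ 3 :=
    calc ∑ x ∈ S, w x ≤ ∑ x ∈ P.image fun ab => pairTripleProd ab.1 ab.2, w x :=
          Finset.sum_le_sum_of_subset_of_nonneg himage fun x _ _ => by positivity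
      _ ≤ ∑ ab ∈ P, w (pairTripleProd ab.1 ab.2) :=
          Finset.sum_image_le_of_nonneg fun x _ => by positivity
      _ = (∑ b ∈ Icc 1 N, (b : ℝ)⁻¹) ^ Fintype.card ι ^ 2 *
            (∑ b ∈ Icc 1 N, ((b : ℝ) * √b)⁻¹) ^ Fintype.card ι ^ 3 := by
          simp only [hwprod]
          rw [hP, Finset.sum_product]
          dsimp only
          rw [← Finset.sum_mul_sum,
            Finset.sum_prod_piFinset (Icc 1 N) fun _ b => (b : ℝ)⁻¹,
            Finset.sum_prod_piFinset (Icc 1 N) fun _ b => ((b : ℝ) * √b)⁻¹]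
          simp [pow_succ, mul_assoc]
      _ ≤ _ := by
          gcongr
          · exact sum_inv_le_one_add_log N
          · exact sum_inv_mul_sqrt_le N
  calc (#S : ℝ) = ∑ x ∈ S, 1 := by simp
    _ ≤ ∑ x ∈ S, √((N : ℝ) ^ Fintype.card ι) * w x := Finset.sum_le_sum hwle
    _ = √((N : ℝ) ^ Fintype.card ι) * ∑ x ∈ S, w x := by rw [mul_sum]
    _ ≤ _ := by gcongr

theorem sum_mul_prod_erase {ι F : Type*} [Fintype ι] [DecidableEq ι] [Field F] (e x : ι → F)
    (hx : ∀ i, x i ≠ 0) :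
    ∑ i, e i * ∏ j ∈ univ.erase i, x j = (∏ i, x i) * ∑ i, e i * (x i)⁻¹ := by
  rw [mul_sum]
  refine sum_congr rfl fun i _ => ?_
  rw [← mul_prod_erase univ x (mem_univ i)]
  field_simp [hx i]

theorem sq_dvd_prod_of_sum_eq_zero {ι : Type*} [Fintype ι] [DecidableEq ι] (x : ι → ℕ)
    (e : ι → ℤ) (he : ∀ i, IsUnit (e i))
    (h : ∑ i, e i * ∏ j ∈ univ.erase i, (x j : ℤ) = 0) (q : ℕ) (hq : q.Prime)
    (hqx : q ∣ ∏ i, x i) : q ^ 2 ∣ ∏ i, x i := by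
  obtain ⟨i, -, hi⟩ := (hq.prime.dvd_finsetProd_iff x).1 hqx
  have hdvd : (x i : ℤ) ∣ e i * ∏ j ∈ univ.erase i, (x j : ℤ) := by
    rw [← add_sum_erase univ _ (mem_univ i)] at h
    rw [eq_neg_of_add_eq_zero_left h, dvd_neg]
    refine dvd_sum fun j hj => Dvd.dvd.mul_left ?_ _
    exact dvd_prod_of_mem (fun j => (x j : ℤ)) (mem_erase.2 ⟨(ne_of_mem_erase hj).symm, mem_univ i⟩)
  rw [(he i).dvd_mul_left] at hdvd
  have hdvd' : x i ∣ ∏ j ∈ univ.erase i, x j := by exact_mod_cast hdvd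
  rw [← mul_prod_erase univ x (mem_univ i), sq]
  exact mul_dvd_mul hi (hi.trans hdvd')

theorem card_real_solutions_le (k N : ℕ) (T : Finset (Fin k → ℕ))
    (hT : T ⊆ Fintype.piFinset fun _ => Icc 1 N) :
    (#((T ×ˢ T).filter fun xy => ∑ i, (xy.1 i : ℚ)⁻¹ = ∑ i, (xy.2 i : ℚ)⁻¹) : ℝ) ≤
      (N : ℝ) ^ k * ((1 + Real.log N) ^ (2 * k) ^ 2 * 3 ^ (2 * k) ^ 3) := by
  set D := (T ×ˢ T).filter fun xy => ∑ i, (xy.1 i : ℚ)⁻¹ = ∑ i, (xy.2 i : ℚ)⁻¹ with hD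
  have hmem : ∀ x ∈ T, ∀ i, 1 ≤ x i ∧ x i ≤ N := fun x hx i =>
    mem_Icc.1 (Fintype.mem_piFinset.1 (hT hx) i)
  have hinj : Set.InjOn (fun xy : (Fin k → ℕ) × (Fin k → ℕ) => Sum.elim xy.1 xy.2) D := by
    rintro ⟨x, y⟩ - ⟨x', y'⟩ - h
    exact Prod.ext (funext fun i => congrFun h (Sum.inl i)) (funext fun i => congrFun h (Sum.inr i))
  rw [← card_image_of_injOn hinj]
  refine (card_powerful_tuples_le N _ ?_ ?_).trans_eq ?_
  · intro z hz
    obtain ⟨⟨x, y⟩, hxy, rfl⟩ := mem_image.1 hz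
    simp only [hD, mem_filter, mem_product] at hxy
    rw [Fintype.mem_piFinset]
    rintro (i | i)
    · exact mem_Icc.2 (hmem x hxy.1.1 i)
    · exact mem_Icc.2 (hmem y hxy.1.2 i)
  · intro z hz
    obtain ⟨⟨x, y⟩, hxy, rfl⟩ := mem_image.1 hz
    simp only [hD, mem_filter, mem_product] at hxy
    refine sq_dvd_prod_of_sum_eq_zero _ (Sum.elim (fun _ => 1) fun _ => -1) ?_ ?_
    · rintro (i | i) <;> simp
    · have h := sum_mul_prod_erase (F := ℚ)
        (fun i => ((Sum.elim (fun _ => 1) (fun _ => -1) i : ℤ) : ℚ))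
        (fun i => ((Sum.elim x y i : ℕ) : ℚ)) (by
          rintro (i | i)
          · exact Nat.cast_ne_zero.2 (Nat.one_le_iff_ne_zero.1 (hmem x hxy.1.1 i).1)
          · exact Nat.cast_ne_zero.2 (Nat.one_le_iff_ne_zero.1 (hmem y hxy.1.2 i).1))
      have h0 : ∑ i : Fin k ⊕ Fin k, ((Sum.elim (fun _ => 1) (fun _ => -1) i : ℤ) : ℚ) *
          ((Sum.elim x y i : ℕ) : ℚ)⁻¹ = 0 := by
        rw [Fintype.sum_sum_type]
        simp [hxy.2]
      rw [h0, mul_zero] at h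
      exact_mod_cast h
  · rw [Fintype.card_sum, Fintype.card_fin, ← two_mul, mul_comm 2 k, pow_mul,
      Real.sqrt_sq (by positivity)]

/-- Tuples with congruent but pairwise distinct sums of reciprocals are few. -/
theorem card_congruent_le {p : ℕ} (hp : p.Prime) {k : ℕ} (hk : 0 < k) {N : ℕ} (hN : 0 < N)
    (S : Finset (Fin k → ℕ))
    (hS : S ⊆ Fintype.piFinset fun _ => (Icc 1 N).filter fun x => Nat.Coprime x p)
    (hinj : Set.InjOn (fun x : Fin k → ℕ => ∑ i, (x i : ℚ)⁻¹) S)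
    (hc : ∀ a ∈ S, ∀ b ∈ S, ∑ i, (a i : ZMod p)⁻¹ = ∑ i, (b i : ZMod p)⁻¹) :
    (#S : ℝ) ≤ 2 * (k * (N : ℝ) ^ (2 * k - 1) / p + 1) := by
  have := Fact.mk hp
  have hmem : ∀ x ∈ S, ∀ i, (1 ≤ x i ∧ x i ≤ N) ∧ (x i).Coprime p := by
    intro x hx i
    have := Fintype.mem_piFinset.1 (hS hx) i
    rwa [mem_filter, mem_Icc] at this
  have : Nonempty (Fin k) := ⟨⟨0, hk⟩⟩
  set u : (Fin k → ℕ) → ℕ := fun x => ∑ i, ∏ j ∈ univ.erase i, x j with hu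
  set v : (Fin k → ℕ) → ℕ := fun x => ∏ i, x i with hv
  have hpos : ∀ x ∈ S, ∀ i, 0 < x i := fun x hx i => (hmem x hx i).1.1
  have hvpos : ∀ x ∈ S, 0 < v x := fun x hx => prod_pos fun i _ => hpos x hx i
  have huF : ∀ x ∈ S, ∀ (F : Type) [Field F], (∀ i, (x i : F) ≠ 0) →
      (u x : F) = v x * ∑ i, (x i : F)⁻¹ := by
    intro x _ F _ hne
    have := sum_mul_prod_erase (fun _ => 1) (fun i => (x i : F)) hne
    simp only [one_mul] at this
    rw [hu, hv]
    push_cast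
    exact this
  have huQ : ∀ x ∈ S, (u x : ℚ) = v x * ∑ i, (x i : ℚ)⁻¹ := fun x hx =>
    huF x hx ℚ fun i => Nat.cast_ne_zero.2 (hpos x hx i).ne'
  have huZ : ∀ x ∈ S, (u x : ZMod p) = v x * ∑ i, (x i : ZMod p)⁻¹ := fun x hx =>
    huF x hx (ZMod p) fun i h => by
      rw [ZMod.natCast_eq_zero_iff] at h
      exact (Nat.Prime.coprime_iff_not_dvd hp).1 (hmem x hx i).2.symm h
  have hbound := card_fractions_le S u v hp.pos (A := k * (N : ℝ) ^ (k - 1)) (B := (N : ℝ) ^ k)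
    (by positivity) (by positivity)
    (fun x hx => sum_pos (fun i _ => prod_pos fun j _ => hpos x hx j) univ_nonempty)
    hvpos
    (fun x hx => by
      have : u x ≤ k * N ^ (k - 1) := by
        calc u x ≤ ∑ i : Fin k, N ^ (k - 1) := by
              refine sum_le_sum fun i _ => ?_
              refine (prod_le_pow_card _ x N fun j _ => (hmem x hx j).1.2).trans_eq ?_
              rw [card_erase_of_mem (mem_univ i), card_univ, Fintype.card_fin]
          _ = _ := by simp
      exact_mod_cast this)
    (fun x hx => by
      have : v x ≤ N ^ k := by
        simpa using prod_le_pow_card univ x N fun j _ => (hmem x hx j).1.2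
      exact_mod_cast this)
    (fun a ha b hb hab h => hab <| hinj ha hb <| by
      have h' : (u a : ℚ) * v b = u b * v a := by exact_mod_cast h
      rw [huQ a ha, huQ b hb] at h'
      have ha0 : (v a : ℚ) ≠ 0 := Nat.cast_ne_zero.2 (hvpos a ha).ne'
      have hb0 : (v b : ℚ) ≠ 0 := Nat.cast_ne_zero.2 (hvpos b hb).ne'
      refine mul_left_cancel₀ (mul_ne_zero ha0 hb0) ?_
      linear_combination h')
    (fun a ha b hb => by
      rw [← ZMod.natCast_eq_natCast_iff]
      push_cast
      rw [huZ a ha, huZ b hb, hc a ha b hb]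
      ring)
  rwa [mul_assoc, ← pow_add, show k - 1 + k = 2 * k - 1 by omega] at hbound

/-- for a prime `p`, `k ≥ 1` and `N ≥ 2`, the number `J_{2k}` of tuples
`(x_1,…,x_{2k})` of integers in `[1,N]`, each coprime to `p`, with
`x_1* + … + x_k* ≡ x_{k+1}* + … + x_{2k}* (mod p)` satisfies
`J_{2k} ≤ (2k)^{90k³}·(log N)^{4k²}·(N^{2k−1}/p + 1)·N^k`. -/
theorem stmt_5 (p : ℕ) (hp : p.Prime) (k : ℕ) (hk : 0 < k) (N : ℕ) (hN : 2 ≤ N) :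
    ((((Fintype.piFinset fun _ : Fin k =>
            (Finset.Icc 1 N).filter fun x => Nat.Coprime x p) ×ˢ
          Fintype.piFinset fun _ : Fin k =>
            (Finset.Icc 1 N).filter fun x => Nat.Coprime x p).filter
        (fun xy => (∑ i, ((xy.1 i : ZMod p))⁻¹) = ∑ i, ((xy.2 i : ZMod p))⁻¹)).card : ℝ) ≤
      (2 * (k : ℝ)) ^ (90 * k ^ 3) * Real.log N ^ (4 * k ^ 2) *
        ((N : ℝ) ^ (2 * k - 1) / (p : ℝ) + 1) * (N : ℝ) ^ k := by
  set T : Finset (Fin k → ℕ) :=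
    Fintype.piFinset fun _ => (Finset.Icc 1 N).filter fun x => Nat.Coprime x p with hT
  have hmain := card_collisions_le T (fun x => ∑ i, (x i : ZMod p)⁻¹)
    (fun x => ∑ i, (x i : ℚ)⁻¹) fun S hS hinj hc =>
      card_congruent_le hp hk (by omega : 0 < N) S hS hinj hc
  have hreal := card_real_solutions_le k N T
    (Fintype.piFinset_subset _ _ fun _ => filter_subset _ _)
  have hk1 : (1 : ℝ) ≤ k := by exact_mod_cast hk
  have hlog : 1 / 2 ≤ Real.log N := by
    have h1 : Real.log 2 ≤ Real.log N := Real.log_le_log (by norm_num) (by exact_mod_cast hN)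
    linarith [Real.log_two_gt_d9]
  set X : ℝ := (N : ℝ) ^ (2 * k - 1) / p with hX
  have hX0 : 0 ≤ X := by positivity
  have hfactor : 2 * (k * (N : ℝ) ^ (2 * k - 1) / p + 1) ≤ 2 * k * (X + 1) := by
    rw [mul_div_assoc, ← hX]
    nlinarith
  have hlogpow : (1 + Real.log N) ^ (2 * k) ^ 2 ≤
      3 ^ (4 * k ^ 2) * Real.log N ^ (4 * k ^ 2) := by
    rw [← mul_pow, show (2 * k) ^ 2 = 4 * k ^ 2 by ring]
    gcongr
    linarith
  have hconst : 2 * (k : ℝ) * (3 ^ (4 * k ^ 2) * 3 ^ (2 * k) ^ 3) ≤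
      (2 * (k : ℝ)) ^ (90 * k ^ 3) := by
    have h3 : (3 : ℝ) ≤ (2 * k) ^ 2 := by nlinarith
    calc 2 * (k : ℝ) * (3 ^ (4 * k ^ 2) * 3 ^ (2 * k) ^ 3)
        ≤ 2 * (k : ℝ) * (((2 * k) ^ 2) ^ (4 * k ^ 2) * ((2 * k) ^ 2) ^ (2 * k) ^ 3) := by gcongr
      _ = (2 * (k : ℝ)) ^ (1 + 2 * (4 * k ^ 2) + 2 * (2 * k) ^ 3) := by
          rw [← pow_mul, ← pow_mul, pow_add, pow_add, pow_one, ← mul_assoc]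
      _ ≤ (2 * (k : ℝ)) ^ (90 * k ^ 3) := by
          refine pow_le_pow_right₀ (by linarith) ?_
          have h1 : 1 ≤ k ^ 3 := Nat.one_le_pow _ _ hk
          have h2 : k ^ 2 ≤ k ^ 3 := Nat.pow_le_pow_right hk (by norm_num)
          rw [mul_pow]
          omega
  refine hmain.trans ?_
  calc _ ≤ 2 * k * (X + 1) * ((N : ℝ) ^ k *
          (3 ^ (4 * k ^ 2) * Real.log N ^ (4 * k ^ 2) * 3 ^ (2 * k) ^ 3)) := by
        refine mul_le_mul hfactor (hreal.trans ?_) (Nat.cast_nonneg _) (by positivity)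
        gcongr
    _ = 2 * (k : ℝ) * (3 ^ (4 * k ^ 2) * 3 ^ (2 * k) ^ 3) * Real.log N ^ (4 * k ^ 2) * (X + 1) *
          (N : ℝ) ^ k := by ring
    _ ≤ _ := by gcongr
end

section
/- Let p be a prime, k a positive integer, and N a positive integer. Then the number J_{2k} of tuples (x_1,…,x_{2k}) of prime numbers with x_i ≤ N, each x_i ≠ p, satisfying the congruence x_1* + … + x_k* ≡ x_{k+1}* + … + x_{2k}* (mod p), satisfies J_{2k} ≤ (2k)^{k}·(N^{2k−1}/p + 1)·N^{k}. -/
open Finset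

/-- Nonnegative fractions of bounded numerator `≤ A` and denominator `≤ B` that reduce to a fixed
residue `l` modulo `p` number at most `2⌊AB/p⌋ + 1`. -/
theorem card_rat_of_residue_le (p : ℕ) (hp : 0 < p) (l : ZMod p) (A B : ℕ) (F : Finset ℚ)
    (h : ∀ f ∈ F, 0 ≤ f.num ∧ f.num ≤ A ∧ f.den ≤ B ∧ (f.num : ZMod p) = l * f.den) :
    #F ≤ 2 * (A * B / p) + 1 := by
  obtain rfl | hF := F.eq_empty_or_nonempty
  · simp
  obtain ⟨g, hg, hmax⟩ := F.exists_max_image (fun f => f.den) hF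
  obtain ⟨hg0, hgA, hgB, hgl⟩ := h g hg
  have hp' : (0 : ℤ) < p := by exact_mod_cast hp
  have hdvd : ∀ f ∈ F, (p : ℤ) ∣ f.num * g.den - g.num * f.den := by
    intro f hf
    obtain ⟨-, -, -, hfl⟩ := h f hf
    rw [← ZMod.intCast_zmod_eq_zero_iff_dvd]
    push_cast
    rw [hfl, hgl]
    ring
  have hcard : #(Icc (-((A * B / p : ℕ) : ℤ)) ((A * B / p : ℕ) : ℤ)) = 2 * (A * B / p) + 1 := by
    rw [Int.card_Icc]
    omega
  rw [← hcard]
  refine card_le_card_of_injOn (fun f => (f.num * g.den - g.num * f.den) / p) ?_ ?_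
  · intro f hf
    obtain ⟨hf0, hfA, hfB, -⟩ := h f hf
    obtain ⟨c, hc⟩ := hdvd f hf
    have h1 : f.num * g.den ≤ A * B :=
      mul_le_mul hfA (by exact_mod_cast hgB) (by positivity) (by positivity)
    have h2 : g.num * f.den ≤ A * B :=
      mul_le_mul hgA (by exact_mod_cast hfB) (by positivity) (by positivity)
    have h3 : 0 ≤ f.num * g.den := by positivity
    have h4 : 0 ≤ g.num * f.den := by positivity
    simp only [hc, coe_Icc, Set.mem_Icc, Nat.cast_mul, Int.natCast_ediv]
    rw [Int.mul_ediv_cancel_left _ hp'.ne', neg_le, Int.le_ediv_iff_mul_le hp',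
      Int.le_ediv_iff_mul_le hp']
    constructor <;> linarith
  · intro f hf f' hf' heq
    have heq' := (Int.ediv_left_inj (hdvd f hf) (hdvd f' hf')).1 heq
    have hdiv : (g.den : ℤ) ∣ f.den - f'.den := by
      have : (g.den : ℤ) ∣ g.num * (f.den - f'.den) :=
        ⟨f.num - f'.num, by linear_combination -heq'⟩
      exact (Rat.isCoprime_num_den g).symm.dvd_of_dvd_mul_left this
    have h1 := hmax f hf
    have h2 := hmax f' hf'
    have h3 := f.den_pos
    have h4 := f'.den_pos
    have hden : (f.den : ℤ) = f'.den := by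
      have := Int.eq_zero_of_abs_lt_dvd hdiv (by rw [abs_lt]; constructor <;> omega)
      omega
    refine Rat.ext ?_ (by exact_mod_cast hden)
    rw [hden] at heq'
    exact mul_right_cancel₀ (b := (g.den : ℤ)) (by exact_mod_cast g.den_ne_zero)
      (sub_left_injective heq')

/-- If two sums of reciprocals of `k` primes agree, any prime exceeding `k` that occurs in one
occurs in the other. -/
theorem exists_eq_of_sum_inv_eq {k : ℕ} {x y : Fin k → ℕ} (hx : ∀ i, (x i).Prime)
    (hy : ∀ i, (y i).Prime) (h : ∑ i, (x i : ℚ)⁻¹ = ∑ i, (y i : ℚ)⁻¹) (i : Fin k)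
    (hi : k < x i) : ∃ j, y j = x i := by
  by_contra! hne
  have : Fact (x i).Prime := ⟨hx i⟩
  have hunit : ∀ q : ℕ, q.Prime → q ≠ x i → padicNorm (x i) (q : ℚ)⁻¹ ≤ 1 := by
    intro q hq hqi
    have : padicNorm (x i) (q : ℚ) = 1 := by
      rw [padicNorm.nat_eq_one_iff, Nat.prime_dvd_prime_iff_eq (hx i) hq]
      exact hqi.symm
    rw [← one_div, padicNorm.div, this, padicNorm.one, div_one]
  set r := #{j | x j = x i} with hr
  have hr0 : 0 < r := card_pos.2 ⟨i, by simp⟩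
  have hrk : r ≤ k := by simpa using card_le_univ {j | x j = x i}
  have hsplit : (r : ℚ) / x i = ∑ j, (y j : ℚ)⁻¹ - ∑ j with x j ≠ x i, (x j : ℚ)⁻¹ := by
    rw [← h, ← sum_filter_add_sum_filter_not univ (fun j => x j = x i), add_sub_cancel_right,
      sum_congr rfl (g := fun _ => (x i : ℚ)⁻¹) (fun j hj => by rw [(mem_filter.1 hj).2]),
      sum_const, nsmul_eq_mul, div_eq_mul_inv]
  have hle : padicNorm (x i) ((r : ℚ) / x i) ≤ 1 := by
    rw [hsplit]
    refine padicNorm.sub.trans (max_le ?_ ?_)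
    · exact padicNorm.sum_le' (fun j _ => hunit _ (hy j) (hne j)) zero_le_one
    · exact padicNorm.sum_le' (fun j hj => hunit _ (hx j) (mem_filter.1 hj).2) zero_le_one
  have hrn : padicNorm (x i) (r : ℚ) = 1 := by
    rw [padicNorm.nat_eq_one_iff]
    exact fun hd => absurd (Nat.le_of_dvd hr0 hd) (by omega)
  rw [padicNorm.div, hrn, padicNorm.padicNorm_p_of_prime, one_div, inv_inv] at hle
  have := (hx i).one_lt
  exact absurd hle (not_le.2 (by exact_mod_cast this))

/-- At most `(2k)^(k-1)` tuples of `k` primes have a prescribed rational sum of reciprocals. -/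
theorem card_sum_inv_eq_le {k : ℕ} (hk : 0 < k) (S : Finset (Fin k → ℕ))
    (hS : ∀ x ∈ S, ∀ i, (x i).Prime) (r : ℚ) (hr : ∀ x ∈ S, ∑ i, (x i : ℚ)⁻¹ = r) :
    #S ≤ (2 * k) ^ (k - 1) := by
  obtain ⟨n, rfl⟩ : ∃ n, k = n + 1 := ⟨k - 1, by omega⟩
  obtain rfl | ⟨y, hy⟩ := S.eq_empty_or_nonempty
  · simp
  set U : Finset ℕ := univ.image y ∪ Icc 1 (n + 1) with hU
  have hUcard : #U ≤ 2 * (n + 1) := by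
    have h1 : #(univ.image y) ≤ n + 1 := by simpa using card_image_le (s := univ) (f := y)
    have h2 := card_union_le (univ.image y) (Icc 1 (n + 1))
    rw [Nat.card_Icc, ← hU] at h2
    omega
  have hmem : ∀ x ∈ S, ∀ i, x i ∈ U := by
    intro x hx i
    rw [hU, mem_union, mem_Icc]
    by_cases hi : n + 1 < x i
    · obtain ⟨j, hj⟩ := exists_eq_of_sum_inv_eq (hS x hx) (hS y hy)
        ((hr x hx).trans (hr y hy).symm) i hi
      exact Or.inl (mem_image.2 ⟨j, mem_univ _, hj⟩)
    · exact Or.inr ⟨(hS x hx i).one_le, by omega⟩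
  calc #S ≤ #(Fintype.piFinset fun _ : Fin n => U) := by
        refine card_le_card_of_injOn (fun x i => x i.succ) ?_ ?_
        · intro x hx
          simpa using fun i : Fin n => hmem x hx i.succ
        · intro x hx x' hx' heq
          have heq' : ∀ i : Fin n, x i.succ = x' i.succ := fun i => congrFun heq i
          have hsum := (hr x hx).trans (hr x' hx').symm
          rw [Fin.sum_univ_succ, Fin.sum_univ_succ] at hsum
          simp only [heq', add_left_inj, inv_inj, Nat.cast_inj] at hsum
          funext i
          exact Fin.cases hsum heq' i
    _ = #U ^ n := by simp
    _ ≤ (2 * (n + 1)) ^ (n + 1 - 1) := Nat.pow_le_pow_left hUcard n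

/-- Size and residue of the reduced fraction equal to a sum of reciprocals. -/
theorem sum_inv_num_den {p : ℕ} (hp : p.Prime) {k N : ℕ} {x : Fin k → ℕ}
    (hx : ∀ i, (x i).Prime ∧ x i ≠ p ∧ x i ≤ N) :
    let f : ℚ := ∑ i, (x i : ℚ)⁻¹
    0 ≤ f.num ∧ f.num ≤ (k * N ^ (k - 1) : ℕ) ∧ f.den ≤ N ^ k ∧
      (f.num : ZMod p) = (∑ i, (x i : ZMod p)⁻¹) * f.den := by
  intro f
  have : Fact p.Prime := ⟨hp⟩
  set P := ∏ i, x i with hP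
  set s := ∑ i, ∏ j ∈ univ.erase i, x j with hs
  have hPpos : 0 < P := prod_pos fun i _ => (hx i).1.pos
  have key : ∀ (K : Type) [Field K], (∀ i, (x i : K) ≠ 0) →
      (∑ i, (x i : K)⁻¹) * P = (s : K) := by
    intro K _ h0
    rw [hP, hs, sum_mul, Nat.cast_sum]
    refine sum_congr rfl fun i _ => ?_
    rw [← mul_prod_erase univ x (mem_univ i), Nat.cast_mul, inv_mul_cancel_left₀ (h0 i)]
  have hQ : f * P = s := key ℚ fun i => by exact_mod_cast (hx i).1.ne_zero
  have hxp : ∀ i, (x i : ZMod p) ≠ 0 := by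
    intro i h0
    rw [ZMod.natCast_eq_zero_iff, Nat.prime_dvd_prime_iff_eq hp (hx i).1] at h0
    exact (hx i).2.1 h0.symm
  have hZ := key (ZMod p) hxp
  have hPp : (P : ZMod p) ≠ 0 := by
    rw [hP, Nat.cast_prod]
    exact prod_ne_zero_iff.2 fun i _ => hxp i
  have hcross : f.num * P = s * f.den := by
    have hf : (f.num : ℚ) = f * f.den := (Rat.mul_den_eq_num f).symm
    have : (f.num : ℚ) * P = s * f.den := by rw [hf, ← hQ]; ring
    exact_mod_cast this
  have hdvd : f.den ∣ P := by
    have : (f.den : ℤ) ∣ f.num * P := ⟨s, by rw [hcross, mul_comm]⟩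
    exact_mod_cast (Rat.isCoprime_num_den f).symm.dvd_of_dvd_mul_left this
  have hdenP := Nat.le_of_dvd hPpos hdvd
  refine ⟨Rat.num_nonneg.2 (sum_nonneg fun i _ => by positivity), ?_, ?_, ?_⟩
  · have hsle : s ≤ k * N ^ (k - 1) := by
      refine (sum_le_card_nsmul univ _ (N ^ (k - 1)) fun i _ => ?_).trans (by simp)
      refine (prod_le_pow_card _ _ N fun j _ => (hx j).2.2).trans (by simp)
    have h1 : f.num * P ≤ s * P := by
      rw [hcross]
      exact mul_le_mul_of_nonneg_left (by exact_mod_cast hdenP) (by positivity)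
    have h2 : f.num ≤ s := le_of_mul_le_mul_right h1 (by exact_mod_cast hPpos)
    exact h2.trans (by exact_mod_cast hsle)
  · exact hdenP.trans ((prod_le_pow_card _ _ N fun j _ => (hx j).2.2).trans (by simp))
  · have h1 : (f.num : ZMod p) * P = s * f.den := by
      exact_mod_cast congrArg (Int.cast : ℤ → ZMod p) hcross
    refine mul_right_cancel₀ hPp ?_
    rw [h1, ← hZ]
    ring

/-- The number of `k`-tuples of primes up to `N` whose reciprocals sum to a given residue. -/
theorem card_sum_inv_residue_le {p : ℕ} (hp : p.Prime) {k N : ℕ} (hk : 0 < k) (l : ZMod p)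
    (S : Finset (Fin k → ℕ)) (hS : ∀ x ∈ S, ∀ i, (x i).Prime ∧ x i ≠ p ∧ x i ≤ N)
    (hl : ∀ x ∈ S, ∑ i, (x i : ZMod p)⁻¹ = l) :
    #S ≤ (2 * k) ^ (k - 1) * (2 * (k * N ^ (k - 1) * N ^ k / p) + 1) := by
  refine (card_le_mul_card_image (f := fun x => ∑ i, (x i : ℚ)⁻¹) S _ fun r _ =>
    card_sum_inv_eq_le hk _ (fun x hx i => (hS x (mem_filter.1 hx).1 i).1) r
      fun x hx => (mem_filter.1 hx).2).trans ?_
  refine Nat.mul_le_mul_left _ (card_rat_of_residue_le p hp.pos l _ _ _ ?_)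
  intro f hf
  obtain ⟨x, hx, rfl⟩ := mem_image.1 hf
  rw [← hl x hx]
  exact sum_inv_num_den hp (hS x hx)

/-- for a prime `p`, `k ≥ 1` and `N ≥ 1`, the number `J_{2k}` of tuples
`(x_1,…,x_{2k})` of prime numbers `x_i ≤ N`, each `x_i ≠ p`, with
`x_1* + … + x_k* ≡ x_{k+1}* + … + x_{2k}* (mod p)` satisfies
`J_{2k} ≤ (2k)^k·(N^{2k−1}/p + 1)·N^k`. -/
theorem stmt_6 (p : ℕ) (hp : p.Prime) (k : ℕ) (hk : 0 < k) (N : ℕ) (hN : 0 < N) :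
    ((((Fintype.piFinset fun _ : Fin k =>
            (Finset.Icc 1 N).filter fun x => x.Prime ∧ x ≠ p) ×ˢ
          Fintype.piFinset fun _ : Fin k =>
            (Finset.Icc 1 N).filter fun x => x.Prime ∧ x ≠ p).filter
        (fun xy => (∑ i, ((xy.1 i : ZMod p))⁻¹) = ∑ i, ((xy.2 i : ZMod p))⁻¹)).card : ℝ) ≤
      (2 * (k : ℝ)) ^ k * ((N : ℝ) ^ (2 * k - 1) / (p : ℝ) + 1) * (N : ℝ) ^ k := by
  set Q := (Finset.Icc 1 N).filter fun x => x.Prime ∧ x ≠ p with hQ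
  have hQcard : #Q ≤ N := (card_filter_le _ _).trans (by simp)
  set T := Fintype.piFinset fun _ : Fin k => Q with hT
  have hTcard : #T ≤ N ^ k := by
    rw [hT, Fintype.card_piFinset_const]
    exact Nat.pow_le_pow_left hQcard k
  have hmem : ∀ x ∈ T, ∀ i, (x i).Prime ∧ x i ≠ p ∧ x i ≤ N := by
    intro x hx i
    have := Fintype.mem_piFinset.1 hx i
    rw [hQ, mem_filter, mem_Icc] at this
    exact ⟨this.2.1, this.2.2, this.1.2⟩
  set M := k * N ^ (k - 1) * N ^ k with hM
  have hcount : #((T ×ˢ T).filter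
      (fun xy => (∑ i, ((xy.1 i : ZMod p))⁻¹) = ∑ i, ((xy.2 i : ZMod p))⁻¹)) ≤
      (2 * k) ^ (k - 1) * (2 * (M / p) + 1) * #T := by
    refine card_le_mul_card_image_of_maps_to (f := Prod.fst)
      (fun xy hxy => (mem_product.1 (mem_filter.1 hxy).1).1) _ fun x _ => ?_
    have hinj : Set.InjOn Prod.snd (((T ×ˢ T).filter
        (fun xy => (∑ i, ((xy.1 i : ZMod p))⁻¹) = ∑ i, ((xy.2 i : ZMod p))⁻¹)).filter
          (fun xy => xy.1 = x) : Set ((Fin k → ℕ) × (Fin k → ℕ))) := by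
      intro a ha b hb hab
      exact Prod.ext ((mem_filter.1 ha).2.trans (mem_filter.1 hb).2.symm) hab
    rw [← card_image_of_injOn hinj]
    refine card_sum_inv_residue_le hp hk (∑ i, ((x i : ZMod p))⁻¹) _ ?_ ?_
    · intro y hy
      obtain ⟨xy, hxy, rfl⟩ := mem_image.1 hy
      exact hmem _ (mem_product.1 (mem_filter.1 (mem_filter.1 hxy).1).1).2
    · intro y hy
      obtain ⟨xy, hxy, rfl⟩ := mem_image.1 hy
      obtain ⟨hxy', rfl⟩ := mem_filter.1 hxy
      exact (mem_filter.1 hxy').2.symm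
  have hk1 : (1 : ℝ) ≤ k := by exact_mod_cast hk
  have hMp : ((M / p : ℕ) : ℝ) ≤ k * (N : ℝ) ^ (2 * k - 1) / p := by
    refine Nat.cast_div_le.trans (le_of_eq ?_)
    rw [hM, show 2 * k - 1 = (k - 1) + k by omega, pow_add]
    push_cast
    ring
  calc _ ≤ (((2 * k) ^ (k - 1) * (2 * (M / p) + 1) * #T : ℕ) : ℝ) := by exact_mod_cast hcount
    _ ≤ (2 * (k : ℝ)) ^ (k - 1) * (2 * (k * (N : ℝ) ^ (2 * k - 1) / p) + 2 * k) * (N : ℝ) ^ k := by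
      push_cast
      gcongr
      · linarith
      · exact_mod_cast hTcard
    _ = (2 * (k : ℝ)) ^ k * ((N : ℝ) ^ (2 * k - 1) / (p : ℝ) + 1) * (N : ℝ) ^ k := by
      rw [← mul_pow_sub_one hk.ne' (2 * (k : ℝ))]
      ring
end
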